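/- Let p ∈ [0,1] and set r = 2/(p+1). Then for every u ∈ C_c^∞(ℝ²), (∫_{ℝ²} |u(x)|^r dx)^{1/r} ≤ (π^{1/r}/(2π)) ∫_{ℝ²} |∇u(x)| |x|^p dx. -/

import Mathlib

open MeasureTheory Real

/-! ### Part 1: one-dimensional comparison -/

noncomputable def hsG (q v : ℝ) : ℝ := q * exp ((1 - q) * v) + (1 - q) * exp (-(q * v))
noncomputable def hsG' (q v : ℝ) : ℝ := q * (1 - q) * (exp ((1 - q) * v) - exp (-(q * v)))
noncomputable def hsL (q t : ℝ) : ℝ := log (((1 - q) * sinh (q * t)) / (q * sinh ((1 - q) * t)))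

lemma hsG_hasDerivAt (q v : ℝ) : HasDerivAt (hsG q) (hsG' q v) v := by
  have h1 : HasDerivAt (fun v : ℝ => exp ((1 - q) * v)) (exp ((1 - q) * v) * ((1 - q) * 1)) v :=
    ((hasDerivAt_id v).const_mul (1 - q)).exp
  have h2 : HasDerivAt (fun v : ℝ => exp (-(q * v))) (exp (-(q * v)) * (-(q * 1))) v :=
    (((hasDerivAt_id v).const_mul q).neg).exp
  have h := (h1.const_mul q).add (h2.const_mul (1 - q))
  refine (h.congr_deriv ?_)
  unfold hsG'; ring

lemma hsG'_pos {q v : ℝ} (h0 : 0 < q) (h1 : q < 1) (hv : 0 < v) : 0 < hsG' q v := by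
  unfold hsG'
  have : exp (-(q * v)) < exp ((1 - q) * v) := by
    apply exp_lt_exp.2; nlinarith
  have : 0 < 1 - q := by linarith
  apply mul_pos (mul_pos h0 this); linarith

lemma hsG'_neg {q v : ℝ} (h0 : 0 < q) (h1 : q < 1) (hv : v < 0) : hsG' q v < 0 := by
  unfold hsG'
  have : exp ((1 - q) * v) < exp (-(q * v)) := by
    apply exp_lt_exp.2; nlinarith
  have : 0 < 1 - q := by linarith
  apply mul_neg_of_pos_of_neg (mul_pos h0 this); linarith

lemma hsL_hasDerivAt {q t : ℝ} (h0 : 0 < q) (h1 : q < 1) (ht : 0 < t) :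
    DifferentiableAt ℝ (hsL q) t := by
  have h1' : 0 < 1 - q := by linarith
  have hs1 : 0 < sinh (q * t) := sinh_pos_iff.2 (by positivity)
  have hs2 : 0 < sinh ((1 - q) * t) := sinh_pos_iff.2 (by positivity)
  unfold hsL
  apply DifferentiableAt.log
  · apply DifferentiableAt.div
    · fun_prop
    · fun_prop
    · positivity
  · positivity

lemma hsL_exp {q t : ℝ} (h0 : 0 < q) (h1 : q < 1) (ht : 0 < t) :
    exp (hsL q t) * (q * sinh ((1 - q) * t)) = (1 - q) * sinh (q * t) := by
  have h1' : 0 < 1 - q := by linarith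
  have hs1 : 0 < sinh (q * t) := sinh_pos_iff.2 (by positivity)
  have hs2 : 0 < sinh ((1 - q) * t) := sinh_pos_iff.2 (by positivity)
  unfold hsL
  rw [exp_log (by positivity)]
  field_simp

/-- `g (μ + t) = g (μ - t)` iff the midpoint is the explicit one. -/
lemma hsG_eq_iff {q t μ : ℝ} :
    hsG q (μ + t) - hsG q (μ - t) =
      2 * exp (-(q * μ)) * (exp μ * (q * sinh ((1 - q) * t)) - (1 - q) * sinh (q * t)) := by
  have e1 : exp ((1 - q) * (μ + t)) = exp (-(q * μ)) * exp μ * exp ((1 - q) * t) := by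
    rw [← exp_add, ← exp_add]; ring_nf
  have e2 : exp ((1 - q) * (μ - t)) = exp (-(q * μ)) * exp μ * exp (-((1 - q) * t)) := by
    rw [← exp_add, ← exp_add]; ring_nf
  have e3 : exp (-(q * (μ + t))) = exp (-(q * μ)) * exp (-(q * t)) := by
    rw [← exp_add]; ring_nf
  have e4 : exp (-(q * (μ - t))) = exp (-(q * μ)) * exp (q * t) := by
    rw [← exp_add]; ring_nf
  unfold hsG
  rw [e1, e2, e3, e4, sinh_eq, sinh_eq]
  ring

lemma hsG_symm {q t : ℝ} (h0 : 0 < q) (h1 : q < 1) (ht : 0 < t) :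
    hsG q (hsL q t + t) = hsG q (hsL q t - t) := by
  have := @hsG_eq_iff q t (hsL q t)
  rw [hsL_exp h0 h1 ht, sub_self, mul_zero] at this
  linarith

lemma hsG_mid {q t μ : ℝ} (h0 : 0 < q) (h1 : q < 1) (ht : 0 < t)
    (h : hsG q (μ + t) = hsG q (μ - t)) : μ = hsL q t := by
  have := @hsG_eq_iff q t μ
  rw [h, sub_self] at this
  have h3 : exp μ * (q * sinh ((1 - q) * t)) - (1 - q) * sinh (q * t) = 0 := by
    rcases mul_eq_zero.1 this.symm with h | h
    · exact absurd h (by positivity)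
    · exact h
  rw [← hsL_exp h0 h1 ht, ← sub_mul] at h3
  have h1' : 0 < 1 - q := by linarith
  have hs2 : 0 < sinh ((1 - q) * t) := sinh_pos_iff.2 (by positivity)
  rcases mul_eq_zero.1 h3 with h | h
  · exact exp_injective (by linarith)
  · exact absurd h (by positivity)

lemma hs_sinh_le {s : ℝ} (hs : 0 < s) : sinh s < s * exp s := by
  rw [sinh_eq]
  have h : 1 - 2 * s < exp (-(2 * s)) := by
    have := add_one_lt_exp (x := -(2*s)) (by linarith)
    linarith
  have h2 : exp (-s) = exp s * exp (-(2*s)) := by rw [← exp_add]; ring_nf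
  rw [h2]
  nlinarith [exp_pos s]

lemma hsL_bounds {q t : ℝ} (h0 : 0 < q) (h1 : q < 1) (ht : 0 < t) :
    0 < hsL q t + t ∧ hsL q t - t < 0 := by
  have h1' : 0 < 1 - q := by linarith
  have hs1 : 0 < sinh (q * t) := sinh_pos_iff.2 (by positivity)
  have hs2 : 0 < sinh ((1 - q) * t) := sinh_pos_iff.2 (by positivity)
  have key := hsL_exp h0 h1 ht
  have a1 : sinh ((1 - q) * t) < (1 - q) * t * exp t := by
    refine (hs_sinh_le (by positivity)).trans ?_
    gcongr; nlinarith
  have a2 : sinh (q * t) < q * t * exp t := by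
    refine (hs_sinh_le (by positivity)).trans ?_
    gcongr; nlinarith
  have a3 : q * t < sinh (q * t) := self_lt_sinh_iff.2 (by positivity)
  have a4 : (1 - q) * t < sinh ((1 - q) * t) := self_lt_sinh_iff.2 (by positivity)
  constructor
  · by_contra hc
    push Not at hc
    have : exp (hsL q t) * exp t ≤ 1 := by rw [← exp_add]; exact exp_le_one_iff.2 hc
    -- (1-q) sinh(qt) e^t = e^{L+t} q sinh((1-q)t) ≤ q sinh((1-q) t)
    have h5 : (1 - q) * sinh (q * t) * exp t ≤ q * sinh ((1 - q) * t) := by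
      rw [← key]
      nlinarith [mul_pos h0 hs2]
    have h6 : (1 - q) * (q * t) * exp t < (1 - q) * sinh (q * t) * exp t := by gcongr
    have h7 : q * sinh ((1 - q) * t) < q * ((1 - q) * t * exp t) := by gcongr
    nlinarith
  · by_contra hc
    push Not at hc
    have : exp t ≤ exp (hsL q t) := exp_le_exp.2 (by linarith)
    have h5 : exp t * (q * sinh ((1 - q) * t)) ≤ (1 - q) * sinh (q * t) := by
      rw [← key]; gcongr
    have h6 : exp t * (q * ((1 - q) * t)) < exp t * (q * sinh ((1 - q) * t)) := by gcongr
    have h7 : (1 - q) * sinh (q * t) < (1 - q) * (q * t * exp t) := by gcongr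
    nlinarith

noncomputable def hsK (q t : ℝ) : ℝ := hsG q (hsL q t + t)

lemma hs_amgm {q a b : ℝ} (h0 : 0 < q) (h1 : q < 1) :
    exp (q * a + (1 - q) * b) ≤ q * exp a + (1 - q) * exp b := by
  have := convexOn_exp.2 (Set.mem_univ a) (Set.mem_univ b) h0.le (by linarith : (0:ℝ) ≤ 1 - q) (by ring)
  simpa [smul_eq_mul] using this

lemma hsK_deriv {q t : ℝ} (h0 : 0 < q) (h1 : q < 1) (ht : 0 < t) :
    ∃ k', HasDerivAt (hsK q) k' t ∧ 0 < k' ∧ 2 * k' ≤ √ (hsK q t ^ 2 - 1) ∧ 1 < hsK q t := by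
  obtain ⟨L', hL⟩ : ∃ L', HasDerivAt (hsL q) L' t := ⟨_, (hsL_hasDerivAt h0 h1 ht).hasDerivAt⟩
  obtain ⟨hp, hm⟩ := hsL_bounds h0 h1 ht
  have d1 : HasDerivAt (hsK q) (hsG' q (hsL q t + t) * (L' + 1)) t :=
    (hsG_hasDerivAt q _).comp t (hL.add (hasDerivAt_id t))
  have d2 : HasDerivAt (hsK q) (hsG' q (hsL q t - t) * (L' - 1)) t := by
    have : HasDerivAt (fun t => hsG q (hsL q t - t)) (hsG' q (hsL q t - t) * (L' - 1)) t :=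
      (hsG_hasDerivAt q _).comp t (hL.sub (hasDerivAt_id t))
    refine this.congr_of_eventuallyEq ?_
    filter_upwards [lt_mem_nhds ht] with s hs
    exact hsG_symm h0 h1 hs
  have e := d1.unique d2
  set x := hsG' q (hsL q t + t) with hx
  set y := - hsG' q (hsL q t - t) with hy
  have hx0 : 0 < x := hsG'_pos h0 h1 hp
  have hy0 : 0 < y := by have := hsG'_neg h0 h1 hm; linarith
  have ek : x * (L' + 1) = 2 * x * y / (x + y) := by
    have : x * (L' + 1) = y * (1 - L') := by rw [e, hy]; ring
    have h3 : (x + y) * (x * (L' + 1)) = 2 * x * y := by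
      have : x * L' + y * L' = y - x := by linarith
      calc (x + y) * (x * (L' + 1)) = x * ((x * L' + y * L') + x + y) := by ring
        _ = _ := by rw [this]; ring
    field_simp at h3 ⊢
    linarith
  rw [ek] at d1
  -- the bound x + y ≤ sqrt (K^2 - 1)
  set αp := exp ((1 - q) * (hsL q t + t)) with hαp
  set βp := exp (-(q * (hsL q t + t))) with hβp
  set αm := exp ((1 - q) * (hsL q t - t)) with hαm
  set βm := exp (-(q * (hsL q t - t))) with hβm
  have K1 : hsK q t = q * αp + (1 - q) * βp := rfl
  have K2 : hsK q t = q * αm + (1 - q) * βm := hsG_symm h0 h1 ht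
  have X1 : x = q * (1 - q) * (αp - βp) := rfl
  have Y1 : y = - (q * (1 - q) * (αm - βm)) := rfl
  have m1 : exp (q * ((1 - q) * (hsL q t - t)) + (1 - q) * (-(q * (hsL q t + t)))) ≤ q * αm + (1 - q) * βp :=
    hs_amgm h0 h1
  have m2 : exp (q * ((1 - q) * (hsL q t + t)) + (1 - q) * (-(q * (hsL q t - t)))) ≤ q * αp + (1 - q) * βm :=
    hs_amgm h0 h1
  have m3 : 1 ≤ (q * αm + (1 - q) * βp) * (q * αp + (1 - q) * βm) := by
    calc (1:ℝ) = exp (q * ((1 - q) * (hsL q t - t)) + (1 - q) * (-(q * (hsL q t + t)))) *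
          exp (q * ((1 - q) * (hsL q t + t)) + (1 - q) * (-(q * (hsL q t - t)))) := by
          rw [← exp_add, ← exp_zero]; ring_nf
      _ ≤ _ := by gcongr
  have S : x + y = hsK q t - (q * αm + (1 - q) * βp) := by
    have : q * αp + (1 - q) * βp = q * αm + (1 - q) * βm := K1.symm.trans K2
    rw [X1, Y1, K1]
    have e2 : q * αp = q * αm + (1 - q) * βm - (1 - q) * βp := by linarith
    linear_combination (-q) * this
  have S2 : (x + y) ^ 2 ≤ hsK q t ^ 2 - 1 := by
    have : q * αp + (1 - q) * βm = 2 * hsK q t - (q * αm + (1 - q) * βp) := by linarith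
    rw [this] at m3
    rw [S]; nlinarith
  refine ⟨_, d1, by positivity, ?_, ?_⟩
  · apply Real.le_sqrt_of_sq_le
    refine le_trans ?_ S2
    have : 2 * (2 * x * y / (x + y)) ≤ x + y := by
      rw [← mul_div_assoc, div_le_iff₀ (by positivity)]
      nlinarith [sq_nonneg (x - y)]
    have h0' : 0 ≤ 2 * (2 * x * y / (x + y)) := by positivity
    gcongr
  · have hK : 0 < hsK q t := by rw [K1]; have : 0 < 1 - q := by linarith
                                positivity
    have : 0 < (x + y)^2 := by positivity
    nlinarith

open MeasureTheory Real

lemma hsK_cont {q : ℝ} (h0 : 0 < q) (h1 : q < 1) : ContinuousOn (hsK q) (Set.Ioi 0) := fun t ht => by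
  obtain ⟨k, hk, -⟩ := hsK_deriv h0 h1 ht
  exact hk.continuousAt.continuousWithinAt

lemma hsK_strictMono {q : ℝ} (h0 : 0 < q) (h1 : q < 1) : StrictMonoOn (hsK q) (Set.Ioi 0) := by
  apply strictMonoOn_of_deriv_pos (convex_Ioi 0) (hsK_cont h0 h1)
  intro t ht
  rw [interior_Ioi] at ht
  obtain ⟨k, hk, h, -⟩ := hsK_deriv h0 h1 ht
  rwa [hk.deriv]

lemma hsG_cont (q : ℝ) : Continuous (hsG q) := by unfold hsG; fun_prop

lemma hsK_surj {q G : ℝ} (h0 : 0 < q) (h1 : q < 1) (hG : 1 < G) : ∃ t > 0, hsK q t = G := by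
  have h1' : 0 < 1 - q := by linarith
  have g0 : hsG q 0 = 1 := by simp [hsG]
  obtain ⟨v, hv, hvG⟩ : ∃ v, 0 < v ∧ hsG q v = G := by
    have hl : 0 ≤ log (G / q) / (1 - q) := by
      apply div_nonneg _ h1'.le
      apply log_nonneg; rw [le_div_iff₀ h0]; linarith
    have hge : G ≤ hsG q (log (G / q) / (1 - q)) := by
      unfold hsG
      have : (1 - q) * (log (G / q) / (1 - q)) = log (G / q) := by field_simp
      rw [this, exp_log (by positivity)]
      have : q * (G / q) = G := by field_simp
      rw [this]
      have := exp_pos (-(q * (log (G / q) / (1 - q))))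
      nlinarith
    obtain ⟨v, hv, e⟩ := intermediate_value_Icc hl (hsG_cont q).continuousOn ⟨g0.le.trans hG.le, hge⟩
    refine ⟨v, lt_of_le_of_ne hv.1 ?_, e⟩
    rintro rfl; linarith
  obtain ⟨w, hw, hwG⟩ : ∃ w, w < 0 ∧ hsG q w = G := by
    have hl : -(log (G / (1 - q)) / q) ≤ 0 := by
      apply neg_nonpos.2
      apply div_nonneg _ h0.le
      apply log_nonneg; rw [le_div_iff₀ h1']; linarith
    have hge : G ≤ hsG q (-(log (G / (1 - q)) / q)) := by
      unfold hsG
      have : -(q * -(log (G / (1 - q)) / q)) = log (G / (1 - q)) := by field_simp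
      rw [this, exp_log (by positivity)]
      have : (1 - q) * (G / (1 - q)) = G := by field_simp
      rw [this]
      have := exp_pos ((1 - q) * -(log (G / (1 - q)) / q))
      nlinarith
    obtain ⟨v, hv, e⟩ := intermediate_value_Icc' hl (hsG_cont q).continuousOn ⟨g0.le.trans hG.le, hge⟩
    refine ⟨v, lt_of_le_of_ne hv.2 ?_, e⟩
    rintro rfl; linarith
  have ht : 0 < (v - w) / 2 := by linarith
  refine ⟨(v - w) / 2, ht, ?_⟩
  have := hsG_mid (q := q) (t := (v - w) / 2) (μ := (v + w) / 2) h0 h1 ht (by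
    rw [show (v + w) / 2 + (v - w) / 2 = v by ring, show (v + w) / 2 - (v - w) / 2 = w by ring, hvG, hwG])
  unfold hsK
  rw [← this, show (v + w) / 2 + (v - w) / 2 = v by ring, hvG]

noncomputable def hsF (τ : ℝ) : ℝ := τ / √ (1 - τ ^ 2)

lemma hsF_nonneg {τ : ℝ} (h : 0 ≤ τ) : 0 ≤ hsF τ := by unfold hsF; positivity

/-- the arccos comparison -/
lemma hs_arccos_comp {q τ₀ ta tb : ℝ} (h0 : 0 < q) (h1 : q < 1) (hτ0 : 0 < τ₀) (hτ1 : τ₀ < 1)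
    (ha : 0 < ta) (hab : ta ≤ tb) (hb : τ₀ * hsK q tb < 1) :
    ENNReal.ofReal (arccos ((1 + τ₀^2 - 2 * (τ₀ * hsK q tb)^2) / (1 - τ₀^2))
      - arccos ((1 + τ₀^2 - 2 * (τ₀ * hsK q ta)^2) / (1 - τ₀^2)))
      ≤ ∫⁻ t in Set.Icc ta tb, ENNReal.ofReal (hsF (τ₀ * hsK q t)) := by
  have hlt : ∀ t ∈ Set.Icc ta tb, 0 < t ∧ τ₀ < τ₀ * hsK q t ∧ τ₀ * hsK q t < 1 := by
    intro t ht
    have ht0 : 0 < t := ha.trans_le ht.1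
    obtain ⟨k, hk, -, -, h1K⟩ := hsK_deriv h0 h1 ht0
    refine ⟨ht0, by nlinarith, lt_of_le_of_lt ?_ hb⟩
    gcongr
    exact (hsK_strictMono h0 h1).monotoneOn ht0 (Set.mem_Ioi.2 (ha.trans_le hab)) ht.2
  have hKc : ContinuousOn (hsK q) (Set.Icc ta tb) := (hsK_cont h0 h1).mono fun t ht => (hlt t ht).1
  have hFc : ContinuousOn (fun t => hsF (τ₀ * hsK q t)) (Set.Icc ta tb) := by
    unfold hsF
    apply ContinuousOn.div
    · fun_prop
    · fun_prop
    · intro t ht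
      obtain ⟨a, b, c⟩ := hlt t ht
      have : 0 < 1 - (τ₀ * hsK q t)^2 := by nlinarith
      positivity
  have hFi := hFc.integrableOn_compact (μ := volume) isCompact_Icc
  have hτ2 : 0 < 1 - τ₀^2 := by nlinarith
  have key := intervalIntegral.sub_le_integral_of_hasDeriv_right_of_le
    (g := fun t => arccos ((1 + τ₀^2 - 2 * (τ₀ * hsK q t)^2) / (1 - τ₀^2)))
    (g' := fun t => deriv (fun t => arccos ((1 + τ₀^2 - 2 * (τ₀ * hsK q t)^2) / (1 - τ₀^2))) t)
    hab (by fun_prop (disch := skip)) (φ := fun t => hsF (τ₀ * hsK q t)) ?_ hFi ?_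
  · rw [intervalIntegral.integral_of_le hab, ← integral_Icc_eq_integral_Ioc] at key
    refine (ENNReal.ofReal_le_ofReal key).trans_eq ?_
    apply ofReal_integral_eq_lintegral_ofReal hFi
    filter_upwards [ae_restrict_mem measurableSet_Icc] with t ht
    exact hsF_nonneg (by have := hlt t ht; linarith)
  all_goals
    intro t ht
    obtain ⟨a, b, c⟩ := hlt t (Set.Ioo_subset_Icc_self ht)
    obtain ⟨k, hk, hk0, hkb, h1K⟩ := hsK_deriv h0 h1 a
    set τ := τ₀ * hsK q t with hτ
    have hY : 1 - ((1 + τ₀^2 - 2 * τ^2) / (1 - τ₀^2)) ^ 2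
        = 4 * ((τ^2 - τ₀^2) * (1 - τ^2)) / (1 - τ₀^2) ^ 2 := by
      field_simp; ring
    have p1 : 0 < τ^2 - τ₀^2 := by nlinarith
    have p2 : 0 < 1 - τ^2 := by nlinarith
    have hYpos : 0 < 1 - ((1 + τ₀^2 - 2 * τ^2) / (1 - τ₀^2)) ^ 2 := by rw [hY]; positivity
    have dY : HasDerivAt (fun t => (1 + τ₀^2 - 2 * (τ₀ * hsK q t)^2) / (1 - τ₀^2))
        (-(4 * τ * (τ₀ * k)) / (1 - τ₀^2)) t := by
      have := ((((hk.const_mul τ₀).pow 2).const_mul 2).const_sub (1 + τ₀^2)).div_const (1 - τ₀^2)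
      refine this.congr_deriv ?_
      simp only [hτ]; push_cast; ring
    have dA := (hasDerivAt_arccos (x := (1 + τ₀^2 - 2 * τ^2) / (1 - τ₀^2))
      (by intro h; rw [h] at hYpos; norm_num at hYpos)
      (by intro h; rw [h] at hYpos; norm_num at hYpos)).comp t dY
    have dA' : HasDerivAt (fun t => arccos ((1 + τ₀^2 - 2 * (τ₀ * hsK q t)^2) / (1 - τ₀^2))) _ t := dA
  · rw [dA'.deriv]; exact dA'.hasDerivWithinAt
  · rw [dA'.deriv]
    rw [hY]
    have : √(4 * ((τ^2 - τ₀^2) * (1 - τ^2)) / (1 - τ₀^2) ^ 2)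
       = 2 * (√(τ^2 - τ₀^2) * √(1 - τ^2)) / (1 - τ₀^2) := by
      rw [sqrt_div (by positivity), sqrt_sq hτ2.le, sqrt_mul (by norm_num), sqrt_mul p1.le]
      congr 2
      rw [show (4:ℝ) = 2^2 by norm_num, sqrt_sq (by norm_num)]
    rw [this]
    have s1 : 0 < √(τ^2 - τ₀^2) := sqrt_pos.2 p1
    have s2 : 0 < √(1 - τ^2) := sqrt_pos.2 p2
    have hb2 : 2 * (τ₀ * k) ≤ √(τ^2 - τ₀^2) := by
      have : τ^2 - τ₀^2 = τ₀^2 * (hsK q t ^ 2 - 1) := by rw [hτ]; ring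
      rw [this, sqrt_mul (by positivity), sqrt_sq hτ0.le]
      nlinarith
    unfold hsF
    have : -(1 / (2 * (√(τ^2 - τ₀^2) * √(1 - τ^2)) / (1 - τ₀^2))) * (-(4 * τ * (τ₀ * k)) / (1 - τ₀^2))
      = (τ / √(1 - τ^2)) * (2 * (τ₀ * k) / √(τ^2 - τ₀^2)) := by
      field_simp; ring
    rw [this]
    have h3 : 2 * (τ₀ * k) / √(τ^2 - τ₀^2) ≤ 1 := by rw [div_le_one s1]; exact hb2
    have h4 : 0 ≤ τ / √(1 - τ^2) := by
      have : 0 < τ := by linarith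
      positivity
    nlinarith

lemma hs_half {q τ₀ : ℝ} (h0 : 0 < q) (h1 : q < 1) (hτ0 : 0 < τ₀) (hτ1 : τ₀ < 1) :
    ENNReal.ofReal π ≤ ∫⁻ t in {t | 0 < t ∧ τ₀ * hsK q t < 1}, ENNReal.ofReal (hsF (τ₀ * hsK q t)) := by
  have hτ2 : 0 < 1 - τ₀^2 := by nlinarith
  have hex : ∀ y, y ∈ Set.Ioo (-1:ℝ) 1 → ∃ t > 0, τ₀ * hsK q t < 1 ∧
      (1 + τ₀^2 - 2 * (τ₀ * hsK q t)^2) / (1 - τ₀^2) = y := by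
    intro y hy
    set z := (1 + τ₀^2 - y * (1 - τ₀^2)) / 2 with hz
    have z1 : τ₀^2 < z := by rw [hz]; nlinarith [hy.2]
    have z2 : z < 1 := by rw [hz]; nlinarith [hy.1]
    have hz0 : 0 ≤ z := by nlinarith [sq_nonneg τ₀]
    obtain ⟨t, ht, e⟩ := hsK_surj (q := q) (G := √z / τ₀) h0 h1 (by
      rw [lt_div_iff₀ hτ0, one_mul]; exact lt_sqrt_of_sq_lt z1)
    have e2 : τ₀ * hsK q t = √z := by rw [e]; field_simp
    refine ⟨t, ht, ?_, ?_⟩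
    · rw [e2, sqrt_lt' one_pos]; linarith
    · rw [e2, sq_sqrt hz0, div_eq_iff hτ2.ne', hz]; ring
  apply ENNReal.le_of_forall_pos_le_add
  intro ε hε _
  set η : ℝ := min (ε / 2) (π / 4) with hη
  have hεr : (0:ℝ) < ε := hε
  have hη0 : 0 < η := by rw [hη]; apply lt_min <;> [linarith; linarith [pi_pos]]
  have hη1 : η ≤ ε / 2 := min_le_left _ _
  have hη2 : η ≤ π / 4 := min_le_right _ _
  have c1 : cos η < 1 := by rw [← cos_zero]; exact cos_lt_cos_of_nonneg_of_le_pi le_rfl (by linarith [pi_pos]) hη0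
  have c2 : 0 < cos η := cos_pos_of_mem_Ioo ⟨by linarith [pi_pos], by linarith [pi_pos]⟩
  obtain ⟨ta, hta, -, ea⟩ := hex (cos η) ⟨by linarith, c1⟩
  obtain ⟨tb, htb, hb1, eb⟩ := hex (cos (π - η)) (by rw [cos_pi_sub]; constructor <;> linarith)
  have hab : ta ≤ tb := by
    by_contra hc
    push Not at hc
    have hl := hsK_strictMono h0 h1 htb hta hc
    have h1b : 1 < hsK q tb := by obtain ⟨k, hk, -, -, h1K⟩ := hsK_deriv h0 h1 htb; exact h1K
    have : cos η ≤ cos (π - η) := by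
      rw [← ea, ← eb]
      gcongr
    rw [cos_pi_sub] at this
    linarith
  have := hs_arccos_comp h0 h1 hτ0 hτ1 hta hab hb1
  rw [ea, eb, arccos_cos (by linarith [pi_pos]) (by linarith), arccos_cos hη0.le (by linarith [pi_pos])] at this
  calc ENNReal.ofReal π ≤ ENNReal.ofReal ((π - η - η) + ε) := ENNReal.ofReal_le_ofReal (by linarith)
    _ = ENNReal.ofReal (π - η - η) + ε := by
      rw [ENNReal.ofReal_add (by linarith) hεr.le]; simp
    _ ≤ _ := by
      gcongr
      refine this.trans (lintegral_mono_set ?_)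
      intro t ht
      refine ⟨hta.trans_le ht.1, lt_of_le_of_lt ?_ hb1⟩
      gcongr
      exact (hsK_strictMono h0 h1).monotoneOn (Set.mem_Ioi.2 (hta.trans_le ht.1)) (Set.mem_Ioi.2 htb) ht.2

/-- Lemma G. -/
lemma hs_lemmaG {q τ₀ : ℝ} (h0 : 0 < q) (h1 : q < 1) (hτ0 : 0 < τ₀) (hτ1 : τ₀ < 1) :
    ENNReal.ofReal (2 * π) ≤ ∫⁻ v in {v | τ₀ * hsG q v < 1}, ENNReal.ofReal (hsF (τ₀ * hsG q v)) := by
  set Ω : Set ℝ := {t | 0 < t ∧ τ₀ * hsK q t < 1} with hΩ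
  have hΩm : MeasurableSet Ω := by
    have : IsOpen Ω := by
      have := ContinuousOn.isOpen_inter_preimage (f := fun t => τ₀ * hsK q t)
        (continuousOn_const.mul (hsK_cont h0 h1)) isOpen_Ioi (isOpen_Iio (a := (1:ℝ)))
      exact this
    exact this.measurableSet
  have hd : ∀ t ∈ Ω, HasDerivAt (hsL q) (deriv (hsL q) t) t := fun t ht =>
    (hsL_hasDerivAt h0 h1 ht.1).hasDerivAt
  have i1 := lintegral_image_eq_lintegral_abs_deriv_mul (s := Ω) (f := fun t => hsL q t + t)
    (f' := fun t => deriv (hsL q) t + 1) hΩm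
    (fun t ht => ((hd t ht).add (hasDerivAt_id t)).hasDerivWithinAt) (by
      intro s hs t ht e
      have : hsK q s = hsK q t := congrArg (hsG q) e
      exact (hsK_strictMono h0 h1).injOn hs.1 ht.1 this) (fun v => ENNReal.ofReal (hsF (τ₀ * hsG q v)))
  have i2 := lintegral_image_eq_lintegral_abs_deriv_mul (s := Ω) (f := fun t => hsL q t - t)
    (f' := fun t => deriv (hsL q) t - 1) hΩm
    (fun t ht => ((hd t ht).sub (hasDerivAt_id t)).hasDerivWithinAt) (by
      intro s hs t ht e
      have : hsG q (hsL q s - s) = hsG q (hsL q t - t) := congrArg (hsG q) e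
      rw [← hsG_symm h0 h1 hs.1, ← hsG_symm h0 h1 ht.1] at this
      exact (hsK_strictMono h0 h1).injOn hs.1 ht.1 this) (fun v => ENNReal.ofReal (hsF (τ₀ * hsG q v)))
  have hm2 : MeasurableSet ((fun t => hsL q t - t) '' Ω) := by
    apply MeasurableSet.image_of_continuousOn_injOn hΩm
    · intro t ht; exact ((hd t ht).sub (hasDerivAt_id t)).continuousAt.continuousWithinAt
    · intro s hs t ht e
      have : hsG q (hsL q s - s) = hsG q (hsL q t - t) := congrArg (hsG q) e
      rw [← hsG_symm h0 h1 hs.1, ← hsG_symm h0 h1 ht.1] at this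
      exact (hsK_strictMono h0 h1).injOn hs.1 ht.1 this
  have hdisj : Disjoint ((fun t => hsL q t + t) '' Ω) ((fun t => hsL q t - t) '' Ω) := by
    rw [Set.disjoint_left]
    rintro _ ⟨s, hs, rfl⟩ ⟨t, ht, e⟩
    have a1 := (hsL_bounds h0 h1 hs.1).1
    have a2 := (hsL_bounds h0 h1 ht.1).2
    simp only at e
    linarith
  calc ENNReal.ofReal (2 * π) = 2 * ENNReal.ofReal π := by
        rw [ENNReal.ofReal_mul (by norm_num)]; simp
    _ ≤ 2 * ∫⁻ t in Ω, ENNReal.ofReal (hsF (τ₀ * hsK q t)) := by gcongr; exact hs_half h0 h1 hτ0 hτ1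
    _ = ∫⁻ t in Ω, 2 * ENNReal.ofReal (hsF (τ₀ * hsK q t)) := by
        rw [lintegral_const_mul' _ _ (by simp)]
    _ ≤ ∫⁻ t in Ω, (ENNReal.ofReal |deriv (hsL q) t + 1| * ENNReal.ofReal (hsF (τ₀ * hsG q (hsL q t + t)))
          + ENNReal.ofReal |deriv (hsL q) t - 1| * ENNReal.ofReal (hsF (τ₀ * hsG q (hsL q t - t)))) := by
        apply setLIntegral_mono' hΩm
        intro t ht
        rw [← hsG_symm h0 h1 ht.1, ← add_mul]
        gcongr ?_ * ?_
        · rw [← ENNReal.ofReal_add (abs_nonneg _) (abs_nonneg _)]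
          rw [show (2:ENNReal) = ENNReal.ofReal 2 by simp]
          apply ENNReal.ofReal_le_ofReal
          have := abs_sub (deriv (hsL q) t + 1) (deriv (hsL q) t - 1)
          ring_nf at this
          rw [abs_of_pos (by norm_num : (0:ℝ) < 2)] at this
          ring_nf; linarith
        · exact le_rfl
    _ = (∫⁻ v in (fun t => hsL q t + t) '' Ω, ENNReal.ofReal (hsF (τ₀ * hsG q v)))
        + ∫⁻ v in (fun t => hsL q t - t) '' Ω, ENNReal.ofReal (hsF (τ₀ * hsG q v)) := by
        rw [i1, i2]
        rw [lintegral_add_left']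
        refine AEMeasurable.mul (f := fun t => ENNReal.ofReal |deriv (hsL q) t + 1|) ?_ ?_
        · apply Measurable.aemeasurable
          have := measurable_deriv (hsL q)
          fun_prop
        · have hK := hsK_cont h0 h1
          apply AEMeasurable.ennreal_ofReal
          have : AEMeasurable (hsK q) (volume.restrict Ω) :=
            (hK.mono (fun t ht => ht.1)).aemeasurable hΩm
          have : AEMeasurable (fun t => τ₀ * hsK q t) (volume.restrict Ω) := this.const_mul _
          have h2 : Measurable hsF := by unfold hsF; fun_prop
          exact h2.comp_aemeasurable this
    _ = ∫⁻ v in ((fun t => hsL q t + t) '' Ω) ∪ ((fun t => hsL q t - t) '' Ω), ENNReal.ofReal (hsF (τ₀ * hsG q v)) := by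
        rw [lintegral_union hm2 hdisj]
    _ ≤ _ := by
        apply lintegral_mono_set
        rintro v (⟨t, ht, rfl⟩ | ⟨t, ht, rfl⟩)
        · exact ht.2
        · have := hsG_symm h0 h1 ht.1
          change τ₀ * hsG q (hsL q t - t) < 1
          rw [← this]; exact ht.2

open MeasureTheory Real

lemma hs_meas_and {α : Type*} [MeasurableSpace α] {P Q : α → Prop} (h1 : MeasurableSet {x | P x})
    (h2 : MeasurableSet {x | Q x}) : MeasurableSet {x | P x ∧ Q x} := h1.inter h2

lemma hsG_ge_one {q v : ℝ} (h0 : 0 < q) (h1 : q < 1) : 1 ≤ hsG q v := by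
  have := hs_amgm (a := (1 - q) * v) (b := -(q * v)) h0 h1
  rw [show q * ((1 - q) * v) + (1 - q) * -(q * v) = 0 by ring, exp_zero] at this
  exact this

/-- Lemma W. -/
lemma hs_lemmaW {p lam c R : ℝ} (hp0 : 0 ≤ p) (hp1 : p < 1) (hl : 0 < lam) (hc : 0 < c) (hR : 0 < R)
    (hRk : lam * R ^ 2 + c < R ^ (p + 1)) :
    ENNReal.ofReal π ≤ ∫⁻ r in {r | 0 < r ∧ lam * r ^ 2 + c < r ^ (p + 1)},
      ENNReal.ofReal ((lam * r ^ 2 + c) / (r * √ ((r ^ (p + 1)) ^ 2 - (lam * r ^ 2 + c) ^ 2))) := by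
  obtain ⟨q, hq⟩ : ∃ q, q = (p + 1) / 2 := ⟨_, rfl⟩
  have h0 : 0 < q := by rw [hq]; linarith
  have h1 : q < 1 := by rw [hq]; linarith
  have h1' : 0 < 1 - q := by linarith
  set x0 := q * c / ((1 - q) * lam) with hx0
  have hx0p : 0 < x0 := by positivity
  set τ₀ := c / ((1 - q) * x0 ^ q) with hτ₀
  have hx0q : 0 < x0 ^ q := by positivity
  have hτ0 : 0 < τ₀ := by positivity
  set φ : ℝ → ℝ := fun v => √x0 * exp (v / 2) with hφ
  have hφpos : ∀ v, 0 < φ v := fun v => by positivity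
  have hφ2 : ∀ v, φ v ^ 2 = x0 * exp v := fun v => by
    simp only [hφ]
    rw [mul_pow, sq_sqrt hx0p.le, ← exp_nat_mul]; congr 2; push_cast; ring
  have hφf : ∀ v, φ v ^ (p + 1) = x0 ^ q * exp (q * v) := fun v => by
    have : p + 1 = (2:ℕ) * q := by rw [hq]; push_cast; ring
    rw [this, rpow_mul (hφpos v).le, rpow_natCast, hφ2, mul_rpow hx0p.le (exp_pos v).le, ← exp_mul]
    ring_nf
  have hφk : ∀ v, lam * φ v ^ 2 + c = τ₀ * hsG q v * φ v ^ (p + 1) := fun v => by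
    rw [hφ2, hφf]
    unfold hsG
    have e1 : exp ((1 - q) * v) * exp (q * v) = exp v := by rw [← exp_add]; ring_nf
    have e2 : exp (-(q * v)) * exp (q * v) = 1 := by rw [← exp_add]; simp
    have : τ₀ * (q * exp ((1 - q) * v) + (1 - q) * exp (-(q * v))) * (x0 ^ q * exp (q * v))
      = τ₀ * x0 ^ q * (q * (exp ((1 - q) * v) * exp (q * v)) + (1 - q) * (exp (-(q * v)) * exp (q * v))) := by ring
    rw [this, e1, e2]
    have : τ₀ * x0 ^ q = c / (1 - q) := by rw [hτ₀]; field_simp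
    rw [this, hx0]
    field_simp
  have hτ1 : τ₀ < 1 := by
    have e : φ (log (R ^ 2 / x0)) = R := by
      have : φ (log (R ^ 2 / x0)) ^ 2 = R ^ 2 := by
        rw [hφ2, exp_log (by positivity)]; field_simp
      exact (pow_left_inj₀ (hφpos _).le hR.le two_ne_zero).1 this
    have := hφk (log (R ^ 2 / x0))
    rw [e] at this
    rw [this] at hRk
    have hf : 0 < R ^ (p + 1) := by positivity
    have h2 : τ₀ * hsG q (log (R ^ 2 / x0)) < 1 := by
      by_contra hcon
      push Not at hcon
      nlinarith
    have := hsG_ge_one (v := log (R ^ 2 / x0)) h0 h1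
    nlinarith
  set V : Set ℝ := {v | τ₀ * hsG q v < 1} with hV
  have hVm : MeasurableSet V := by
    have hcts := hsG_cont q
    exact (isOpen_lt (by fun_prop) continuous_const).measurableSet
  have hφd : ∀ v, HasDerivAt φ (φ v / 2) v := fun v => by
    have := (((hasDerivAt_id v).div_const 2).exp).const_mul (√x0)
    refine this.congr_deriv ?_
    simp only [hφ, id]; ring
  have hφinj : Function.Injective φ := by
    intro a b hab
    have : φ a ^ 2 = φ b ^ 2 := by rw [hab]
    rw [hφ2, hφ2] at this
    exact exp_injective (mul_left_cancel₀ hx0p.ne' this)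
  have key := lintegral_image_eq_lintegral_abs_deriv_mul hVm (fun v _ => (hφd v).hasDerivWithinAt)
    hφinj.injOn (fun r => ENNReal.ofReal ((lam * r ^ 2 + c) / (r * √ ((r ^ (p + 1)) ^ 2 - (lam * r ^ 2 + c) ^ 2))))
  have hG := hs_lemmaG h0 h1 hτ0 hτ1
  calc ENNReal.ofReal π = ENNReal.ofReal (1 / 2) * ENNReal.ofReal (2 * π) := by
        rw [← ENNReal.ofReal_mul (by norm_num)]; congr 1; ring
    _ ≤ ENNReal.ofReal (1 / 2) * ∫⁻ v in V, ENNReal.ofReal (hsF (τ₀ * hsG q v)) := by gcongr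
    _ = ∫⁻ v in V, ENNReal.ofReal (1 / 2) * ENNReal.ofReal (hsF (τ₀ * hsG q v)) := by
        rw [lintegral_const_mul' _ _ (by simp)]
    _ = _ := by
        rw [← lintegral_congr]
        intro v
        rw [abs_of_pos (by have := hφpos v; positivity), ← ENNReal.ofReal_mul (half_pos (hφpos v)).le,
          ← ENNReal.ofReal_mul (by norm_num)]
        congr 1
        rw [hφk]
        have hf : 0 < φ v ^ (p + 1) := by have := hφpos v; positivity
        generalize φ v ^ (p + 1) = f at hf
        have : f ^ 2 - (τ₀ * hsG q v * f) ^ 2 = f ^ 2 * (1 - (τ₀ * hsG q v) ^ 2) := by ring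
        rw [this, sqrt_mul (by positivity), sqrt_sq hf.le]
        unfold hsF
        have := hφpos v
        by_cases hs : √(1 - (τ₀ * hsG q v) ^ 2) = 0
        · rw [hs]; simp
        · field_simp
    _ = ∫⁻ r in φ '' V, ENNReal.ofReal ((lam * r ^ 2 + c) / (r * √ ((r ^ (p + 1)) ^ 2 - (lam * r ^ 2 + c) ^ 2))) := key.symm
    _ ≤ _ := by
        apply lintegral_mono_set
        rintro _ ⟨v, hv, rfl⟩
        refine ⟨hφpos v, ?_⟩
        rw [hφk]
        have hf : 0 < φ v ^ (p + 1) := by have := hφpos v; positivity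
        have hv' : τ₀ * hsG q v < 1 := hv
        nlinarith

/-- one-dimensional antiderivative estimate -/
lemma hs_sqrt_layer {f k₀ D : ℝ} (hk : 0 ≤ k₀) :
    ∫⁻ k in {k | k₀ < k ∧ k < k₀ + D ∧ k < f}, ENNReal.ofReal (k / √ (f ^ 2 - k ^ 2))
      ≤ ENNReal.ofReal (√ (f ^ 2 - k₀ ^ 2)) := by
  rcases le_or_gt f k₀ with h | h
  · have : {k | k₀ < k ∧ k < k₀ + D ∧ k < f} = ∅ := by
      ext k; simp only [Set.mem_ofPred_eq, Set.mem_empty_iff_false, iff_false]; rintro ⟨a, b, c⟩; linarith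
    rw [this]; simp
  have hd : ∀ k ∈ Set.Ioo k₀ f, HasDerivAt (fun k => -√ (f ^ 2 - k ^ 2)) (k / √ (f ^ 2 - k ^ 2)) k := by
    intro k hk'
    have h2 : 0 < f ^ 2 - k ^ 2 := by nlinarith [hk'.1, hk'.2]
    have h3 : HasDerivAt (fun k : ℝ => f ^ 2 - k ^ 2) (-(2 * k)) k := by
      simpa using (hasDerivAt_pow 2 k).const_sub (f^2)
    have := h3.sqrt h2.ne'
    refine this.neg.congr_deriv ?_
    have : 0 < √ (f ^ 2 - k ^ 2) := sqrt_pos.2 h2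
    field_simp
  have hcont : ContinuousOn (fun k => -√ (f ^ 2 - k ^ 2)) (Set.Icc k₀ f) := by fun_prop
  have hi : IntegrableOn (fun k => k / √ (f ^ 2 - k ^ 2)) (Set.Ioc k₀ f) := 
    intervalIntegral.integrableOn_deriv_of_nonneg hcont hd (fun k hk' => by
      have : 0 < k := lt_of_le_of_lt hk hk'.1
      positivity)
  have hIntg := intervalIntegral.integral_eq_sub_of_hasDerivAt_of_le h.le hcont hd
    ((intervalIntegrable_iff_integrableOn_Ioc_of_le h.le).2 hi)
  calc _ ≤ ∫⁻ k in Set.Ioc k₀ f, ENNReal.ofReal (k / √ (f ^ 2 - k ^ 2)) := by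
        apply lintegral_mono_set
        rintro k ⟨a, b, c⟩; exact ⟨a, c.le⟩
    _ = ENNReal.ofReal (∫ k in Set.Ioc k₀ f, k / √ (f ^ 2 - k ^ 2)) := by
        rw [ofReal_integral_eq_lintegral_ofReal hi]
        filter_upwards [ae_restrict_mem measurableSet_Ioc] with k hk'
        have : 0 < k := lt_of_le_of_lt hk hk'.1
        simp only [Pi.zero_apply]; positivity
    _ = _ := by
        rw [← intervalIntegral.integral_of_le h.le, hIntg]
        simp

noncomputable def hsZ (p lam c r : ℝ) : ℝ := √ ((r ^ (p + 1)) ^ 2 - (lam * r ^ 2 + c) ^ 2) / r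

/-- Lemma JA. -/
lemma hs_lemmaJA {p lam c a b X : ℝ} (hp0 : 0 ≤ p) (hp1 : p ≤ 1) (hl : 0 < lam) (hc : 0 ≤ c) (hX : 0 ≤ X)
    (ha : 0 ≤ a)
    (hsub : ∀ r, 0 < r → lam * r ^ 2 + c < r ^ (p + 1) → r ∈ Set.Ioo a b) :
    ENNReal.ofReal (π * (X ^ (p + 1) - lam * X ^ 2 - c)) ≤
      ∫⁻ r in Set.Ioo a b, ENNReal.ofReal (hsZ p lam c r) := by
  set D := X ^ (p + 1) - lam * X ^ 2 - c with hD
  rcases le_or_gt D 0 with hD0 | hD0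
  · rw [ENNReal.ofReal_of_nonpos (by nlinarith [pi_pos])]; exact zero_le
  have hXp : 0 < X := by
    rcases hX.eq_or_lt with h | h
    · rw [← h, zero_rpow (by linarith)] at hD
      nlinarith
    · exact h
  have hp1' : p < 1 := by
    refine lt_of_le_of_ne hp1 ?_
    rintro rfl
    have hl1 : lam < 1 := by
      rw [show (1:ℝ) + 1 = (2:ℕ) by norm_num, rpow_natCast] at hD
      by_contra hcon
      push Not at hcon
      nlinarith [sq_nonneg X]
    have hx1 := hsub (X + |b|) (by positivity) (by
      rw [show (1:ℝ) + 1 = (2:ℕ) by norm_num, rpow_natCast] at hD ⊢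
      have := abs_nonneg b
      have h5 : X ^ 2 ≤ (X + |b|) ^ 2 := by gcongr; linarith
      nlinarith)
    have := hx1.2
    have := le_abs_self b
    linarith
  -- the double integrand
  set H : ℝ → ℝ → ENNReal := fun r k => 
    Set.indicator {x : ℝ × ℝ | 0 < x.1 ∧ c < x.2 ∧ x.2 < c + D ∧ lam * x.1 ^ 2 + x.2 < x.1 ^ (p + 1)}
      (fun x => ENNReal.ofReal ((lam * x.1 ^ 2 + x.2) / (x.1 * √ ((x.1 ^ (p + 1)) ^ 2 - (lam * x.1 ^ 2 + x.2) ^ 2)))) (r, k)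
    with hH
  have hset : MeasurableSet {x : ℝ × ℝ | 0 < x.1 ∧ c < x.2 ∧ x.2 < c + D ∧ lam * x.1 ^ 2 + x.2 < x.1 ^ (p + 1)} := by
    refine hs_meas_and (measurableSet_lt (by fun_prop) (by fun_prop)) ?_
    refine hs_meas_and (measurableSet_lt (by fun_prop) (by fun_prop)) ?_
    refine hs_meas_and (measurableSet_lt (by fun_prop) (by fun_prop)) ?_
    exact (measurableSet_lt (by fun_prop) (by fun_prop))
  have hHm : Measurable (Function.uncurry H) := by
    have : Function.uncurry H = Set.indicator {x : ℝ × ℝ | 0 < x.1 ∧ c < x.2 ∧ x.2 < c + D ∧ lam * x.1 ^ 2 + x.2 < x.1 ^ (p + 1)}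
      (fun x => ENNReal.ofReal ((lam * x.1 ^ 2 + x.2) / (x.1 * √ ((x.1 ^ (p + 1)) ^ 2 - (lam * x.1 ^ 2 + x.2) ^ 2)))) := by
      funext ⟨r, k⟩; rfl
    rw [this]
    apply Measurable.indicator _ hset
    fun_prop
  have lower : ENNReal.ofReal (π * D) ≤ ∫⁻ k, ∫⁻ r, H r k := by
    calc ENNReal.ofReal (π * D) = ∫⁻ k in Set.Ioo c (c + D), ENNReal.ofReal π := by
          rw [setLIntegral_const, Real.volume_Ioo, ENNReal.ofReal_mul pi_pos.le]; ring_nf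
      _ ≤ ∫⁻ k in Set.Ioo c (c + D), ∫⁻ r, H r k := by
          apply setLIntegral_mono' measurableSet_Ioo
          intro k hk
          refine (hs_lemmaW hp0 hp1' hl (lt_of_le_of_lt hc hk.1) hXp (by have := hk.2; rw [hD] at this; linarith)).trans_eq ?_
          rw [← lintegral_indicator]
          · congr 1; funext r
            simp only [hH, Set.indicator_apply]
            congr 1
            simp only [eq_iff_iff]
            exact ⟨fun h => ⟨h.1, hk.1, hk.2, h.2⟩, fun h => ⟨h.1, h.2.2.2⟩⟩
          · refine hs_meas_and (measurableSet_lt (by fun_prop) (by fun_prop)) ?_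
            exact (measurableSet_lt (by fun_prop) (by fun_prop))
      _ ≤ _ := setLIntegral_le_lintegral _ _
  have upper : ∀ r, ∫⁻ k, H r k ≤ Set.indicator (Set.Ioo a b) (fun r => ENNReal.ofReal (hsZ p lam c r)) r := by
    intro r
    by_cases hr : 0 < r ∧ lam * r ^ 2 + c < r ^ (p + 1)
    · rw [Set.indicator_of_mem (hsub r hr.1 hr.2)]
      have hr0 := hr.1
      have e : ∀ k, H r k = Set.indicator {κ | lam * r ^ 2 + c < κ ∧ κ < lam * r ^ 2 + c + D ∧ κ < r ^ (p + 1)}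
          (fun κ => ENNReal.ofReal (1 / r) * ENNReal.ofReal (κ / √ ((r ^ (p + 1)) ^ 2 - κ ^ 2))) (lam * r ^ 2 + k) := by
        intro k
        simp only [hH, Set.indicator_apply]
        congr 1
        · simp only [eq_iff_iff]
          exact ⟨fun ⟨h1, h2, h3, h4⟩ => ⟨by linarith, by linarith, h4⟩, fun ⟨h1, h2, h3⟩ => ⟨hr0, by linarith, by linarith, h3⟩⟩
        · rw [← ENNReal.ofReal_mul (by positivity)]; congr 1
          rw [div_mul_div_comm, one_mul]
      simp_rw [e]
      rw [lintegral_add_left_eq_self (μ := volume) (fun κ => Set.indicator {κ | lam * r ^ 2 + c < κ ∧ κ < lam * r ^ 2 + c + D ∧ κ < r ^ (p + 1)}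
          (fun κ => ENNReal.ofReal (1 / r) * ENNReal.ofReal (κ / √ ((r ^ (p + 1)) ^ 2 - κ ^ 2))) κ) (lam * r ^ 2)]
      rw [lintegral_indicator, lintegral_const_mul' _ _ (by simp)]
      · calc _ ≤ ENNReal.ofReal (1 / r) * ENNReal.ofReal (√ ((r ^ (p + 1)) ^ 2 - (lam * r ^ 2 + c) ^ 2)) := by
              gcongr; exact hs_sqrt_layer (by positivity)
          _ = _ := by
            rw [← ENNReal.ofReal_mul (by positivity)]; congr 1; unfold hsZ; ring
      · refine hs_meas_and (measurableSet_lt (by fun_prop) (by fun_prop)) ?_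
        refine hs_meas_and (measurableSet_lt (by fun_prop) (by fun_prop)) ?_
        exact (measurableSet_lt (by fun_prop) (by fun_prop))
    · have : ∀ k, H r k = 0 := by
        intro k
        simp only [hH]
        apply Set.indicator_of_notMem
        rintro ⟨h1, h2, h3, h4⟩
        exact hr ⟨h1, by simp only at h4; linarith⟩
      simp [this]
  calc ENNReal.ofReal (π * D) ≤ ∫⁻ k, ∫⁻ r, H r k := lower
    _ = ∫⁻ r, ∫⁻ k, H r k := by
        rw [lintegral_lintegral_swap]
        exact (hHm.comp measurable_swap).aemeasurable
    _ ≤ ∫⁻ r, Set.indicator (Set.Ioo a b) (fun r => ENNReal.ofReal (hsZ p lam c r)) r := lintegral_mono upper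
    _ = _ := lintegral_indicator measurableSet_Ioo _

open MeasureTheory Real

lemma hs_pow_diff {n y m : ℝ} (h1 : 1 ≤ n) (h2 : n ≤ 2) (hm : 0 ≤ m) (hy : m < y) :
    y ^ n - m ^ n ≤ (y - m) ^ (n - 1) * (y + m) := by
  have hy0 : 0 < y := lt_of_le_of_lt hm hy
  obtain ⟨z, hz⟩ : ∃ z, z = m / y := ⟨_, rfl⟩
  have hz0 : 0 ≤ z := by rw [hz]; positivity
  have hz1 : z < 1 := by rw [hz, div_lt_one hy0]; exact hy
  have em : m = y * z := by rw [hz]; field_simp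
  have e1 : m ^ n = y ^ n * z ^ n := by rw [em, mul_rpow hy0.le hz0]
  have e2 : (y - m) ^ (n - 1) * (y + m) = y ^ n * ((1 - z) ^ (n - 1) * (1 + z)) := by
    rw [em, show y - y * z = y * (1 - z) by ring, mul_rpow hy0.le (by linarith), rpow_sub_one hy0.ne']
    field_simp
  have b1 : (1 - z) ≤ (1 - z) ^ (n - 1) := by
    conv_lhs => rw [← rpow_one (1 - z)]
    exact rpow_le_rpow_of_exponent_ge (by linarith) (by linarith) (by linarith)
  have b2 : z ^ (2:ℝ) ≤ z ^ n := by
    rcases hz0.eq_or_lt with h | h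
    · rw [← h, zero_rpow (by norm_num), zero_rpow (by linarith)]
    · exact rpow_le_rpow_of_exponent_ge h hz1.le h2
  rw [rpow_two] at b2
  rw [e1, e2]
  have hyn : 0 < y ^ n := by positivity
  have : 1 - z ^ n ≤ (1 - z) ^ (n - 1) * (1 + z) := by nlinarith
  nlinarith

noncomputable def hsh (n lam e y : ℝ) : ℝ := (lam * y ^ n - e) / y

lemma hs_levels {n lam e t : ℝ} (h1 : 1 < n) (h2 : n ≤ 2) (hl : 0 < lam) (he : 0 ≤ e) (ht : 0 < t) :
    (volume.restrict (Set.Ioi (0:ℝ))) {y | t < √ (1 - hsh n lam 0 y ^ 2)}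
      ≤ (volume.restrict (Set.Ioi (0:ℝ))) {y | t < √ (1 - hsh n lam e y ^ 2)} := by
  rw [Measure.restrict_apply' measurableSet_Ioi, Measure.restrict_apply' measurableSet_Ioi]
  rcases le_or_gt 1 t with h | h
  · have : {y | t < √ (1 - hsh n lam 0 y ^ 2)} ∩ Set.Ioi 0 = ∅ := by
      rw [Set.eq_empty_iff_forall_notMem]
      rintro y ⟨hy, -⟩
      have hy' : t < √ (1 - hsh n lam 0 y ^ 2) := hy
      have : √ (1 - hsh n lam 0 y ^ 2) ≤ 1 := by
        rw [Real.sqrt_le_iff]; constructor <;> nlinarith [sq_nonneg (hsh n lam 0 y)]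
      linarith
    rw [this]; simp
  obtain ⟨σ, hσ⟩ : ∃ σ, σ = √ (1 - t ^ 2) := ⟨_, rfl⟩
  have ht2 : 0 < 1 - t ^ 2 := by nlinarith
  have hσ0 : 0 < σ := by rw [hσ]; positivity
  have hσ2 : σ ^ 2 = 1 - t ^ 2 := by rw [hσ, sq_sqrt ht2.le]
  have hiff : ∀ x : ℝ, t < √ (1 - x ^ 2) ↔ |x| < σ := by
    intro x
    rw [lt_sqrt ht.le, ← abs_of_pos hσ0, ← sq_lt_sq, hσ2]
    constructor <;> intro h <;> linarith
  obtain ⟨l, hldef⟩ : ∃ l, l = (σ / lam) ^ (1 / (n - 1)) := ⟨_, rfl⟩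
  have hl0 : 0 < l := by rw [hldef]; positivity
  have hn1 : 0 < n - 1 := by linarith
  have hll : lam * l ^ (n - 1) = σ := by
    rw [hldef, ← rpow_mul (by positivity), one_div_mul_cancel hn1.ne', rpow_one]; field_simp
  have hn0 : 0 < n := by linarith
  obtain ⟨m, hm, hme⟩ : ∃ m, 0 ≤ m ∧ lam * m ^ n + σ * m = e := by
    have hc : Continuous fun m : ℝ => lam * m ^ n + σ * m := by
      have := continuous_rpow_const (q := n) hn0.le
      fun_prop
    obtain ⟨m, hm, h⟩ := intermediate_value_Icc (a := 0) (b := e / σ) (by positivity) hc.continuousOn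
      (show e ∈ Set.Icc (lam * 0 ^ n + σ * 0) (lam * (e / σ) ^ n + σ * (e / σ)) from ⟨by simp [zero_rpow hn0.ne', he], by
        have : σ * (e / σ) = e := by field_simp
        rw [this]
        have : 0 ≤ (e / σ) ^ n := by positivity
        nlinarith⟩)
    exact ⟨m, hm.1, h⟩
  calc volume ({y | t < √ (1 - hsh n lam 0 y ^ 2)} ∩ Set.Ioi 0) ≤ volume (Set.Ioo 0 l) := by
        apply measure_mono
        rintro y ⟨hy, hy0⟩
        have hy0' : 0 < y := hy0
        have hy' := (hiff _).1 hy
        refine ⟨hy0, ?_⟩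
        unfold hsh at hy'
        have h3 := lt_of_le_of_lt (le_abs_self _) hy'
        rw [sub_zero, mul_div_assoc, ← rpow_sub_one hy0'.ne', ← hll] at h3
        have h4 : y ^ (n - 1) < l ^ (n - 1) := lt_of_mul_lt_mul_left h3 hl.le
        exact (rpow_lt_rpow_iff hy0'.le hl0.le hn1).1 h4
    _ = volume (Set.Ioo m (m + l)) := by rw [Real.volume_Ioo, Real.volume_Ioo]; congr 1; ring
    _ ≤ _ := by
        apply measure_mono
        intro y hy
        have hy0 : 0 < y := lt_of_le_of_lt hm hy.1
        refine ⟨?_, hy0⟩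
        refine (hiff _).2 ?_
        unfold hsh
        rw [abs_div, abs_of_pos hy0, div_lt_iff₀ hy0, abs_lt]
        constructor
        · have : m ^ n < y ^ n := rpow_lt_rpow hm hy.1 hn0
          have h6 := hy.1
          rw [← hme]; nlinarith
        · have h5 := hs_pow_diff h1.le h2 hm hy.1
          have h6 : (y - m) ^ (n - 1) < l ^ (n - 1) :=
            rpow_lt_rpow (by linarith [hy.1]) (by linarith [hy.2]) hn1
          have h7 : lam * (y ^ n - m ^ n) < σ * (y + m) := by
            calc lam * (y ^ n - m ^ n) ≤ lam * ((y - m) ^ (n - 1) * (y + m)) := by gcongr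
              _ < lam * (l ^ (n - 1) * (y + m)) := by
                have : 0 < y + m := by linarith
                gcongr
              _ = _ := by rw [← mul_assoc, hll]
          linarith

lemma hs_Z_subst {p lam e : ℝ} (hp0 : 0 ≤ p) :
    ∫⁻ r in Set.Ioi (0:ℝ), ENNReal.ofReal (hsZ p lam (-e) r) =
      ENNReal.ofReal (1 / (p + 1)) * ∫⁻ y in Set.Ioi (0:ℝ), ENNReal.ofReal (√ (1 - hsh (2 / (p + 1)) lam e y ^ 2)) := by
  have hp : 0 < p + 1 := by linarith
  have key := lintegral_image_eq_lintegral_abs_deriv_mul (s := Set.Ioi (0:ℝ)) (f := fun y => y ^ (1 / (p + 1)))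
    (f' := fun y => (1 / (p + 1)) * y ^ (1 / (p + 1) - 1)) measurableSet_Ioi
    (fun y hy => (hasDerivAt_rpow_const (Or.inl (ne_of_gt hy))).hasDerivWithinAt)
    (fun x hx y hy h => by
      have hx' : 0 < x := hx
      have hy' : 0 < y := hy
      exact (rpow_left_inj hx'.le hy'.le (by positivity)).1 h)
    (fun r => ENNReal.ofReal (hsZ p lam (-e) r))
  have him : (fun y : ℝ => y ^ (1 / (p + 1))) '' Set.Ioi (0:ℝ) = Set.Ioi 0 := by
    ext r
    constructor
    · rintro ⟨y, hy, rfl⟩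
      have hy' : 0 < y := hy
      exact Set.mem_Ioi.2 (by positivity)
    · intro hr
      have hr' : 0 < r := hr
      refine ⟨r ^ (p + 1), Set.mem_Ioi.2 (by positivity), ?_⟩
      simp only
      rw [← rpow_mul hr'.le, mul_one_div_cancel hp.ne', rpow_one]
  rw [him] at key
  rw [key, ← lintegral_const_mul' _ _ (by simp)]
  apply setLIntegral_congr_fun measurableSet_Ioi
  intro y hy
  have hy' : 0 < y := hy
  simp only
  rw [abs_of_pos (by positivity), ← ENNReal.ofReal_mul (by positivity), ← ENNReal.ofReal_mul (by positivity)]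
  congr 1
  unfold hsZ hsh
  have e1 : (y ^ (1 / (p + 1))) ^ (p + 1) = y := by
    rw [← rpow_mul hy'.le, one_div_mul_cancel hp.ne', rpow_one]
  have e2 : (y ^ (1 / (p + 1))) ^ 2 = y ^ (2 / (p + 1)) := by
    rw [← rpow_natCast, ← rpow_mul hy'.le]; congr 1; push_cast; ring
  rw [e1, e2, rpow_sub_one hy'.ne']
  have : y ^ 2 - (lam * y ^ (2 / (p + 1)) + -e) ^ 2 = y ^ 2 * (1 - ((lam * y ^ (2 / (p + 1)) - e) / y) ^ 2) := by
    field_simp; ring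
  rw [this, sqrt_mul (by positivity), sqrt_sq hy'.le]
  have : 0 < y ^ (1 / (p + 1)) := by positivity
  field_simp

/-- Lemma JB. -/
lemma hs_lemmaJB {p lam e a b X : ℝ} (hp0 : 0 ≤ p) (hp1 : p ≤ 1) (hl : 0 < lam) (he : 0 ≤ e) (hX : 0 ≤ X)
    (hsub : ∀ r, 0 < r → |lam * r ^ 2 - e| < r ^ (p + 1) → r ∈ Set.Ioo a b) :
    ENNReal.ofReal (π * (X ^ (p + 1) - lam * X ^ 2)) ≤
      ∫⁻ r in Set.Ioo a b, ENNReal.ofReal (hsZ p lam (-e) r) := by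
  rcases le_or_gt (X ^ (p + 1) - lam * X ^ 2) 0 with hD0 | hD0
  · rw [ENNReal.ofReal_of_nonpos (by nlinarith [pi_pos])]; exact zero_le
  have hp1' : p < 1 := by
    refine lt_of_le_of_ne hp1 ?_
    rintro rfl
    rw [show (1:ℝ) + 1 = (2:ℕ) by norm_num, rpow_natCast] at hD0
    have hl1 : lam < 1 := by
      by_contra hcon
      push Not at hcon
      nlinarith [sq_nonneg X]
    set R := 1 + |b| + e with hR
    have hb0 := abs_nonneg b
    have hRR : R ≤ R ^ 2 := by nlinarith
    have hx1 := hsub R (by positivity) (by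
      rw [show (1:ℝ) + 1 = (2:ℕ) by norm_num, rpow_natCast]
      rw [abs_lt]
      constructor
      · nlinarith
      · nlinarith)
    have := hx1.2
    have := le_abs_self b
    linarith
  have hJA := hs_lemmaJA (c := 0) (a := 0) (b := (1 / lam) ^ (1 / (1 - p))) hp0 hp1 hl le_rfl hX le_rfl (by
    intro r hr h
    refine ⟨hr, ?_⟩
    have h1p : 0 < 1 - p := by linarith
    rw [← rpow_lt_rpow_iff hr.le (by positivity) h1p, ← rpow_mul (by positivity), one_div_mul_cancel h1p.ne',
      rpow_one, lt_div_iff₀ hl]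
    have e3 : r ^ 2 = r ^ (1 - p) * r ^ (p + 1) := by
      rw [← rpow_add hr, ← rpow_natCast]; congr 1; push_cast; ring
    rw [add_zero, e3] at h
    have : 0 < r ^ (p + 1) := by positivity
    nlinarith)
  rw [sub_zero] at hJA
  refine hJA.trans ?_
  have hn1 : 1 < 2 / (p + 1) := by rw [lt_div_iff₀ (by linarith)]; linarith
  have hn2 : 2 / (p + 1) ≤ 2 := by rw [div_le_iff₀ (by linarith)]; linarith
  have hmeas : ∀ e, Measurable fun y => √ (1 - hsh (2 / (p + 1)) lam e y ^ 2) := by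
    intro e; unfold hsh; fun_prop
  calc ∫⁻ r in Set.Ioo 0 ((1 / lam) ^ (1 / (1 - p))), ENNReal.ofReal (hsZ p lam 0 r)
      ≤ ∫⁻ r in Set.Ioi 0, ENNReal.ofReal (hsZ p lam (-0) r) := by
        rw [neg_zero]
        exact lintegral_mono_set fun r hr => hr.1
    _ ≤ ∫⁻ r in Set.Ioi 0, ENNReal.ofReal (hsZ p lam (-e) r) := by
        rw [hs_Z_subst hp0, hs_Z_subst hp0]
        gcongr 1
        rw [lintegral_eq_lintegral_meas_lt _ (Filter.Eventually.of_forall fun _ => sqrt_nonneg _) (hmeas _).aemeasurable,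
          lintegral_eq_lintegral_meas_lt _ (Filter.Eventually.of_forall fun _ => sqrt_nonneg _) (hmeas _).aemeasurable]
        apply setLIntegral_mono' measurableSet_Ioi
        intro t ht
        exact hs_levels hn1 hn2 hl he ht
    _ ≤ _ := by
        rw [← lintegral_indicator measurableSet_Ioi, ← lintegral_indicator measurableSet_Ioo]
        apply lintegral_mono
        intro r
        simp only [Set.indicator_apply]
        split_ifs with h1 h2 h2
        · exact le_rfl
        · have h1' : 0 < r := h1
          have : ¬ (|lam * r ^ 2 - e| < r ^ (p + 1)) := fun h => h2 (hsub r h1 h)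
          push Not at this
          unfold hsZ
          rw [sqrt_eq_zero_of_nonpos, zero_div, ENNReal.ofReal_zero]
          have h3 : (r ^ (p + 1)) ^ 2 ≤ |lam * r ^ 2 - e| ^ 2 := by gcongr
          rw [sq_abs] at h3
          rw [← sub_eq_add_neg]; linarith
        · exact zero_le
        · exact le_rfl

open MeasureTheory Real

lemma hs_three {p x y z : ℝ} (hp0 : 0 ≤ p) (hp1 : p ≤ 1) (hx : 0 ≤ x) (hxy : x ≤ y) (hyz : y ≤ z) :
    (z ^ 2 - y ^ 2) * x ^ (p + 1) + (y ^ 2 - x ^ 2) * z ^ (p + 1) ≤ (z ^ 2 - x ^ 2) * y ^ (p + 1) := by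
  have hy : 0 ≤ y := hx.trans hxy
  have hz : 0 ≤ z := hy.trans hyz
  have e : ∀ r : ℝ, 0 ≤ r → r ^ (p + 1) = (r ^ 2) ^ ((p + 1) / 2) := fun r hr => by
    rw [← rpow_natCast, ← rpow_mul hr]; congr 1; push_cast; ring
  rw [e x hx, e y hy, e z hz]
  rcases eq_or_lt_of_le (hxy.trans hyz) with h | h
  · have h1 : y = x := by linarith
    have h2 : z = x := by linarith
    rw [h1, h2]; simp
  have hzx : 0 < z ^ 2 - x ^ 2 := by nlinarith
  have hc := Real.concaveOn_rpow (p := (p + 1) / 2) (by linarith) (by linarith)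
  have w1 : 0 ≤ (z ^ 2 - y ^ 2) / (z ^ 2 - x ^ 2) := div_nonneg (by nlinarith) hzx.le
  have w2 : 0 ≤ (y ^ 2 - x ^ 2) / (z ^ 2 - x ^ 2) := div_nonneg (by nlinarith) hzx.le
  have w3 : (z ^ 2 - y ^ 2) / (z ^ 2 - x ^ 2) + (y ^ 2 - x ^ 2) / (z ^ 2 - x ^ 2) = 1 := by field_simp; ring
  have := hc.2 (show x ^ 2 ∈ Set.Ici (0:ℝ) from sq_nonneg x) (show z ^ 2 ∈ Set.Ici (0:ℝ) from sq_nonneg z)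
    w1 w2 w3
  simp only [smul_eq_mul] at this
  rw [show (z ^ 2 - y ^ 2) / (z ^ 2 - x ^ 2) * x ^ 2 + (y ^ 2 - x ^ 2) / (z ^ 2 - x ^ 2) * z ^ 2 = y ^ 2 by
    field_simp; ring] at this
  have h3 := mul_le_mul_of_nonneg_left this hzx.le
  calc _ = (z ^ 2 - x ^ 2) * ((z ^ 2 - y ^ 2) / (z ^ 2 - x ^ 2) * (x ^ 2) ^ ((p + 1) / 2) +
      (y ^ 2 - x ^ 2) / (z ^ 2 - x ^ 2) * (z ^ 2) ^ ((p + 1) / 2)) := by field_simp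
    _ ≤ _ := h3

lemma hs_chordA {p a b : ℝ} (hp0 : 0 ≤ p) (hp1 : p ≤ 1) (ha : 0 ≤ a) (hab : a < b) :
    ∃ lam c, 0 < lam ∧ 0 ≤ c ∧ lam * a ^ 2 + c = a ^ (p + 1) ∧ lam * b ^ 2 + c = b ^ (p + 1) ∧
      (∀ r, 0 < r → lam * r ^ 2 + c < r ^ (p + 1) → r ∈ Set.Ioo a b) ∧
      (∀ r ∈ Set.Icc a b, |lam * r ^ 2 + c| ≤ r ^ (p + 1)) := by
  have hba : 0 < b ^ 2 - a ^ 2 := by nlinarith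
  have hPab : a ^ (p + 1) < b ^ (p + 1) := rpow_lt_rpow ha hab (by linarith)
  obtain ⟨lam, hlam⟩ : ∃ lam, lam = (b ^ (p + 1) - a ^ (p + 1)) / (b ^ 2 - a ^ 2) := ⟨_, rfl⟩
  have hl : 0 < lam := by rw [hlam]; apply div_pos <;> linarith
  have hl2 : lam * (b ^ 2 - a ^ 2) = b ^ (p + 1) - a ^ (p + 1) := by rw [hlam]; field_simp
  have hk : ∀ r, (lam * r ^ 2 + (a ^ (p + 1) - lam * a ^ 2)) * (b ^ 2 - a ^ 2) =
      a ^ (p + 1) * (b ^ 2 - r ^ 2) + b ^ (p + 1) * (r ^ 2 - a ^ 2) := by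
    intro r; linear_combination (r ^ 2 - a ^ 2) * hl2
  have hc : 0 ≤ a ^ (p + 1) - lam * a ^ 2 := by
    have := hs_three hp0 hp1 le_rfl ha hab.le
    rw [zero_rpow (by linarith)] at this
    have h2 := hk 0
    by_contra hcon
    push Not at hcon
    nlinarith
  refine ⟨lam, a ^ (p + 1) - lam * a ^ 2, hl, hc, by ring, by linarith, ?_, ?_⟩
  · intro r hr h
    have h2 := hk r
    have h3 := mul_lt_mul_of_pos_right h hba
    rw [h2] at h3
    constructor
    · by_contra hcon
      push Not at hcon
      have := hs_three hp0 hp1 hr.le hcon hab.le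
      linarith
    · by_contra hcon
      push Not at hcon
      have := hs_three hp0 hp1 ha hab.le hcon
      linarith
  · intro r hr
    have hr0 : 0 ≤ r := ha.trans hr.1
    rw [abs_of_nonneg (by positivity)]
    have := hs_three hp0 hp1 ha hr.1 hr.2
    have h2 := hk r
    by_contra hcon
    push Not at hcon
    have h3 := mul_lt_mul_of_pos_right hcon hba
    rw [h2] at h3
    linarith

lemma hs_chordB {p a b : ℝ} (hp0 : 0 ≤ p) (hp1 : p ≤ 1) (ha : 0 ≤ a) (hab : a < b) :
    ∃ lam e, 0 < lam ∧ 0 ≤ e ∧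
      (∀ r, 0 < r → |lam * r ^ 2 - e| < r ^ (p + 1) → r ∈ Set.Ioo a b) ∧
      (∀ r ∈ Set.Icc a b, |lam * r ^ 2 - e| ≤ r ^ (p + 1)) := by
  have hba : 0 < b ^ 2 - a ^ 2 := by nlinarith
  have hPab : a ^ (p + 1) < b ^ (p + 1) := rpow_lt_rpow ha hab (by linarith)
  have hPa : 0 ≤ a ^ (p + 1) := by positivity
  obtain ⟨lam, hlam⟩ : ∃ lam, lam = (b ^ (p + 1) + a ^ (p + 1)) / (b ^ 2 - a ^ 2) := ⟨_, rfl⟩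
  have hl : 0 < lam := by rw [hlam]; apply div_pos <;> linarith
  have hl2 : lam * (b ^ 2 - a ^ 2) = b ^ (p + 1) + a ^ (p + 1) := by rw [hlam]; field_simp
  have hk : ∀ r, (lam * r ^ 2 - (a ^ (p + 1) + lam * a ^ 2)) * (b ^ 2 - a ^ 2) =
      - a ^ (p + 1) * (b ^ 2 - r ^ 2) + b ^ (p + 1) * (r ^ 2 - a ^ 2) := by
    intro r; linear_combination (r ^ 2 - a ^ 2) * hl2
  refine ⟨lam, a ^ (p + 1) + lam * a ^ 2, hl, by positivity, ?_, ?_⟩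
  · intro r hr h
    rw [abs_lt] at h
    have h2 := hk r
    have h3 := mul_lt_mul_of_pos_right h.1 hba
    have h4 := mul_lt_mul_of_pos_right h.2 hba
    rw [h2] at h3 h4
    constructor
    · by_contra hcon
      push Not at hcon
      have := hs_three hp0 hp1 hr.le hcon hab.le
      have : 0 ≤ b ^ (p + 1) * (a ^ 2 - r ^ 2) := mul_nonneg (by linarith) (by nlinarith)
      linarith
    · by_contra hcon
      push Not at hcon
      have := hs_three hp0 hp1 ha hab.le hcon
      have : 0 ≤ a ^ (p + 1) * (r ^ 2 - b ^ 2) := mul_nonneg hPa (by nlinarith)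
      linarith
  · intro r hr
    have hr0 : 0 ≤ r := ha.trans hr.1
    have := hs_three hp0 hp1 ha hr.1 hr.2
    have h2 := hk r
    have t1 : 0 ≤ a ^ (p + 1) * (b ^ 2 - r ^ 2) := mul_nonneg hPa (by nlinarith [hr.2])
    have t2 : 0 ≤ b ^ (p + 1) * (r ^ 2 - a ^ 2) := mul_nonneg (by linarith) (by nlinarith [hr.1])
    rw [abs_le]
    constructor
    · by_contra hcon
      push Not at hcon
      have h3 := mul_lt_mul_of_pos_right hcon hba
      rw [h2] at h3
      linarith
    · by_contra hcon
      push Not at hcon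
      have h3 := mul_lt_mul_of_pos_right hcon hba
      rw [h2] at h3
      linarith

open MeasureTheory Real

lemma hs_polar (g : ℂ → ENNReal) (hg : Measurable g) {a b : ℝ} (ha : 0 ≤ a) :
    ∫⁻ z in {z : ℂ | a < ‖z‖ ∧ ‖z‖ < b}, g z =
      ∫⁻ r in Set.Ioo a b, ∫⁻ θ in Set.Ioo (-π) π, ENNReal.ofReal r * g (circleMap 0 r θ) := by
  have hA : MeasurableSet {z : ℂ | a < ‖z‖ ∧ ‖z‖ < b} :=
    hs_meas_and (measurableSet_lt (by fun_prop) (by fun_prop)) (measurableSet_lt (by fun_prop) (by fun_prop))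
  have hcm : Continuous fun x : ℝ × ℝ => circleMap 0 x.1 x.2 := by unfold circleMap; fun_prop
  rw [← lintegral_indicator hA, ← Complex.lintegral_comp_polarCoord_symm, polarCoord_target]
  have e : ∀ x : ℝ × ℝ, Complex.polarCoord.symm x = circleMap 0 x.1 x.2 := by
    intro x
    rw [Complex.polarCoord_symm_apply, circleMap_zero, Complex.exp_mul_I]; simp
  simp_rw [e]
  have hmeas : Measurable fun x : ℝ × ℝ => ENNReal.ofReal x.1 * g (circleMap 0 x.1 x.2) := by
    have : Measurable fun x : ℝ × ℝ => g (circleMap 0 x.1 x.2) := hg.comp hcm.measurable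
    fun_prop
  rw [lintegral_lintegral (f := fun r θ => ENNReal.ofReal r * g (circleMap 0 r θ)) hmeas.aemeasurable,
    Measure.prod_restrict, ← lintegral_indicator (by measurability), ← lintegral_indicator (by measurability)]
  congr 1
  funext x
  simp only [Set.indicator_apply, Set.mem_prod, Set.mem_Ioi, Set.mem_Ioo, Set.mem_ofPred_eq, norm_circleMap_zero]
  by_cases h1 : 0 < x.1
  · rw [abs_of_pos h1]
    by_cases h2 : -π < x.2 ∧ x.2 < π <;> by_cases h3 : a < x.1 ∧ x.1 < b <;> simp [h1, h2, h3]
  · have : ¬ (a < x.1) := by intro h; exact h1 (lt_of_le_of_lt ha h)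
    simp [h1, this]

lemma hs_swap {F : ℝ → ℝ → ℝ} (hF : Continuous fun x : ℝ × ℝ => F x.1 x.2) {a b c d : ℝ} (hab : a ≤ b) (hcd : c ≤ d) :
    ∫ x in a..b, ∫ y in c..d, F x y = ∫ y in c..d, ∫ x in a..b, F x y := by
  rw [intervalIntegral.integral_of_le hab, intervalIntegral.integral_of_le hcd]
  simp_rw [intervalIntegral.integral_of_le hab, intervalIntegral.integral_of_le hcd]
  apply integral_integral_swap
  rw [Measure.prod_restrict]
  have := (hF.continuousOn (s := Set.Icc a b ×ˢ Set.Icc c d)).integrableOn_compact (μ := volume.prod volume) (isCompact_Icc.prod isCompact_Icc)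
  exact this.mono_set (Set.prod_mono Set.Ioc_subset_Icc_self Set.Ioc_subset_Icc_self)

lemma hs_cm_cont : Continuous fun x : ℝ × ℝ => circleMap 0 x.1 x.2 := by unfold circleMap; fun_prop

lemma hs_circleTV {T : ℂ → ℝ} (hT : ContDiff ℝ 1 T) {r : ℝ} {z₁ z₂ : ℂ} (h1 : ‖z₁‖ = r) (h2 : ‖z₂‖ = r) :
    2 * |T z₁ - T z₂| ≤ ∫ θ in (-π)..π, |fderiv ℝ T (circleMap 0 r θ) (circleMap 0 r θ * Complex.I)| := by
  have hD : ∀ θ, HasDerivAt (fun θ => T (circleMap 0 r θ)) (fderiv ℝ T (circleMap 0 r θ) (circleMap 0 r θ * Complex.I)) θ := by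
    intro θ
    exact ((hT.differentiable (by norm_num)) _).hasFDerivAt.comp_hasDerivAt θ (hasDerivAt_circleMap 0 r θ)
  have hc : Continuous fun θ => fderiv ℝ T (circleMap 0 r θ) (circleMap 0 r θ * Complex.I) := by
    have h1 := hT.continuous_fderiv (by norm_num)
    have h2 := continuous_circleMap 0 r
    exact (h1.comp h2).clm_apply (by fun_prop)
  have harg : ∀ z : ℂ, ‖z‖ = r → circleMap 0 r (Complex.arg z) = z := by
    intro z hz; rw [circleMap_zero, ← hz, Complex.norm_mul_exp_arg_mul_I]
  have main : ∀ α β : ℝ, -π ≤ α → α ≤ β → β ≤ π →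
      2 * |T (circleMap 0 r α) - T (circleMap 0 r β)| ≤ ∫ θ in (-π)..π, |fderiv ℝ T (circleMap 0 r θ) (circleMap 0 r θ * Complex.I)| := by
    intro α β h1 h2 h3
    have hb : ∀ x y : ℝ, x ≤ y → |T (circleMap 0 r y) - T (circleMap 0 r x)| ≤
        ∫ θ in x..y, |fderiv ℝ T (circleMap 0 r θ) (circleMap 0 r θ * Complex.I)| := by
      intro x y hxy
      rw [← intervalIntegral.integral_eq_sub_of_hasDerivAt (fun θ _ => hD θ) (hc.intervalIntegrable _ _)]
      exact intervalIntegral.abs_integral_le_integral_abs hxy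
    have i := fun x y : ℝ => (hc.abs).intervalIntegrable (μ := volume) x y
    rw [← intervalIntegral.integral_add_adjacent_intervals (i (-π) α) (i α π),
      ← intervalIntegral.integral_add_adjacent_intervals (i α β) (i β π)]
    have b1 := hb _ _ h1
    have b2 := hb _ _ h2
    have b3 := hb _ _ h3
    have per : circleMap 0 r π = circleMap 0 r (-π) := by
      have := periodic_circleMap 0 r (-π)
      rw [← this]; ring_nf
    rw [per] at b3
    have t1 := abs_add_le (T (circleMap 0 r α) - T (circleMap 0 r (-π))) (T (circleMap 0 r (-π)) - T (circleMap 0 r β))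
    rw [show T (circleMap 0 r α) - T (circleMap 0 r (-π)) + (T (circleMap 0 r (-π)) - T (circleMap 0 r β)) = T (circleMap 0 r α) - T (circleMap 0 r β) by ring] at t1
    have t2 := abs_sub_comm (T (circleMap 0 r α)) (T (circleMap 0 r β))
    linarith
  have a1 := Complex.arg_mem_Ioc z₁
  have a2 := Complex.arg_mem_Ioc z₂
  rcases le_total (Complex.arg z₁) (Complex.arg z₂) with h | h
  · have := main _ _ a1.1.le h a2.2
    rwa [harg _ h1, harg _ h2] at this
  · have := main _ _ a2.1.le h a1.2
    rw [harg _ h1, harg _ h2] at this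
    rwa [abs_sub_comm]

lemma hs_pointwise {D : ℂ →L[ℝ] ℝ} {p lam c r : ℝ} (hr : 0 < r) (hk : |lam * r ^ 2 + c| ≤ r ^ (p + 1)) (θ : ℝ) :
    -(lam * r ^ 2 + c) * D (Complex.exp (θ * Complex.I)) + hsZ p lam c r * |D (circleMap 0 r θ * Complex.I)|
      ≤ ‖D‖ * r ^ (p + 1) := by
  have key : ∀ σ : ℝ, |σ| = 1 → -(lam * r ^ 2 + c) * D (Complex.exp (θ * Complex.I)) + hsZ p lam c r * (σ * D (circleMap 0 r θ * Complex.I))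
      ≤ ‖D‖ * r ^ (p + 1) := by
    intro σ hσ
    set k := lam * r ^ 2 + c with hkdef
    have hq : 0 ≤ (r ^ (p + 1)) ^ 2 - k ^ 2 := by
      have : k ^ 2 ≤ (r ^ (p + 1)) ^ 2 := by rw [← sq_abs k]; gcongr
      linarith
    have e : circleMap 0 r θ * Complex.I = r • (Complex.I * Complex.exp (θ * Complex.I)) := by
      rw [circleMap_zero, Complex.real_smul]; ring
    have hw : -k * D (Complex.exp (θ * Complex.I)) + hsZ p lam c r * (σ * D (circleMap 0 r θ * Complex.I))
        = D ((-k) • Complex.exp (θ * Complex.I) + (hsZ p lam c r * σ * r) • (Complex.I * Complex.exp (θ * Complex.I))) := by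
      rw [e]; simp only [map_add, map_smul, smul_eq_mul]; ring
    rw [hw]
    refine (le_abs_self _).trans ((D.le_opNorm _).trans ?_)
    gcongr
    have : (-k) • Complex.exp (θ * Complex.I) + (hsZ p lam c r * σ * r) • (Complex.I * Complex.exp (θ * Complex.I))
      = (((-k : ℝ) : ℂ) + ((hsZ p lam c r * σ * r : ℝ) : ℂ) * Complex.I) * Complex.exp (θ * Complex.I) := by
      rw [Complex.real_smul, Complex.real_smul]; ring
    rw [this, norm_mul, Complex.norm_exp_ofReal_mul_I, mul_one, Complex.norm_add_mul_I]
    have hZ : hsZ p lam c r * σ * r = √ ((r ^ (p + 1)) ^ 2 - k ^ 2) * σ := by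
      unfold hsZ; rw [← hkdef]; field_simp
    rw [hZ, mul_pow, sq_sqrt hq, ← sq_abs σ, hσ]
    apply le_of_eq
    rw [show (-k) ^ 2 + ((r ^ (p + 1)) ^ 2 - k ^ 2) * 1 ^ 2 = (r ^ (p + 1)) ^ 2 by ring, sqrt_sq (by positivity)]
  rcases abs_choice (D (circleMap 0 r θ * Complex.I)) with h | h
  · rw [h]; have := key 1 (by simp); rwa [one_mul] at this
  · rw [h]; have := key (-1) (by simp); rwa [neg_one_mul] at this

open MeasureTheory Real

lemma hs_ofReal_interval {f : ℝ → ℝ} (hf : Continuous f) {a b : ℝ} (hab : a ≤ b) (h0 : ∀ x ∈ Set.Ioo a b, 0 ≤ f x) :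
    ENNReal.ofReal (∫ x in a..b, f x) = ∫⁻ x in Set.Ioo a b, ENNReal.ofReal (f x) := by
  rw [intervalIntegral.integral_of_le hab, integral_Ioc_eq_integral_Ioo]
  apply ofReal_integral_eq_lintegral_ofReal
  · exact (hf.integrableOn_Icc (a := a) (b := b)).mono_set Set.Ioo_subset_Icc_self
  · filter_upwards [ae_restrict_mem measurableSet_Ioo] with x hx using h0 x hx

lemma hs_cont_param {F : ℝ → ℝ → ℝ} (hF : Continuous fun x : ℝ × ℝ => F x.1 x.2) :
    Continuous fun r => ∫ θ in (-π)..π, F r θ :=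
  intervalIntegral.continuous_parametric_intervalIntegral_of_continuous' hF (-π) π

lemma hs_polar_real {F : ℝ → ℝ → ℝ} (hF : Continuous fun x : ℝ × ℝ => F x.1 x.2) {a b : ℝ} (ha : 0 ≤ a) (hab : a ≤ b)
    (h0 : ∀ r θ, 0 < r → 0 ≤ F r θ) (g : ℂ → ℝ) (hg : Measurable g)
    (h : ∀ r θ, 0 < r → F r θ = r * g (circleMap 0 r θ)) :
    ENNReal.ofReal (∫ r in a..b, ∫ θ in (-π)..π, F r θ) = ∫⁻ z in {z : ℂ | a < ‖z‖ ∧ ‖z‖ < b}, ENNReal.ofReal (g z) := by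
  have hpi : -π ≤ π := by linarith [pi_pos]
  rw [hs_polar _ (hg.ennreal_ofReal) ha, hs_ofReal_interval (hs_cont_param hF) hab]
  · apply setLIntegral_congr_fun measurableSet_Ioo
    intro r hr
    have hr0 : 0 < r := lt_of_le_of_lt ha hr.1
    dsimp only
    have hFr : Continuous fun θ => F r θ := hF.comp (by fun_prop : Continuous fun θ : ℝ => (r, θ))
    rw [hs_ofReal_interval hFr hpi (fun θ _ => h0 r θ hr0)]
    apply lintegral_congr
    intro θ
    rw [h r θ hr0, ENNReal.ofReal_mul hr0.le]
  · intro r hr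
    exact intervalIntegral.integral_nonneg hpi (fun θ _ => h0 r θ (lt_of_le_of_lt ha hr.1))

set_option maxHeartbeats 1000000 in
lemma hs_annulus {p lam c a b : ℝ} (hp0 : 0 ≤ p) (hl : 0 ≤ lam) (ha : 0 ≤ a) (hab : a < b)
    (hk : ∀ r ∈ Set.Icc a b, |lam * r ^ 2 + c| ≤ r ^ (p + 1))
    {T : ℂ → ℝ} (hT : ContDiff ℝ 1 T) (hT0 : ∀ z, 0 ≤ T z) {S : Set ℝ} (hSm : MeasurableSet S)
    (hS : ∀ r ∈ S, r ∈ Set.Ioo a b → ∃ z₁ z₂ : ℂ, ‖z₁‖ = r ∧ ‖z₂‖ = r ∧ T z₁ = 1 ∧ T z₂ = 0)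
    (hA : 0 ≤ (lam * a ^ 2 + c) * (∫ θ in (-π)..π, T (circleMap 0 a θ)) - (lam * b ^ 2 + c) * (∫ θ in (-π)..π, T (circleMap 0 b θ))) :
    ENNReal.ofReal ((lam * a ^ 2 + c) * (∫ θ in (-π)..π, T (circleMap 0 a θ)) - (lam * b ^ 2 + c) * (∫ θ in (-π)..π, T (circleMap 0 b θ)))
      + ENNReal.ofReal (2 * lam) * volume {z : ℂ | (a < ‖z‖ ∧ ‖z‖ < b) ∧ T z = 1}
      + 2 * ∫⁻ r in S ∩ Set.Ioo a b, ENNReal.ofReal (hsZ p lam c r)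
    ≤ ∫⁻ z in {z : ℂ | a < ‖z‖ ∧ ‖z‖ < b}, ENNReal.ofReal (‖fderiv ℝ T z‖ * ‖z‖ ^ p) := by
  have hpi : -π ≤ π := by linarith [pi_pos]
  have hAm : MeasurableSet {z : ℂ | a < ‖z‖ ∧ ‖z‖ < b} :=
    hs_meas_and (measurableSet_lt (by fun_prop) (by fun_prop)) (measurableSet_lt (by fun_prop) (by fun_prop))
  have hfd : Continuous fun z => fderiv ℝ T z := hT.continuous_fderiv (by norm_num)
  have hTc : Continuous T := hT.continuous
  have hfd2 : Continuous fun x : ℝ × ℝ => fderiv ℝ T (circleMap 0 x.1 x.2) := hfd.comp hs_cm_cont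
  have hT2 : Continuous fun x : ℝ × ℝ => T (circleMap 0 x.1 x.2) := hTc.comp hs_cm_cont
  have hpow : Continuous fun r : ℝ => r ^ (p + 1) := Real.continuous_rpow_const (by linarith)
  have hE : Continuous fun x : ℝ × ℝ => fderiv ℝ T (circleMap 0 x.1 x.2) (Complex.exp (x.2 * Complex.I)) :=
    hfd2.clm_apply (by fun_prop)
  -- the two-variable functions
  have hFN : Continuous fun x : ℝ × ℝ => ‖fderiv ℝ T (circleMap 0 x.1 x.2)‖ * x.1 ^ (p + 1) :=
    hfd2.norm.mul (hpow.comp continuous_fst)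
  have hFK : Continuous fun x : ℝ × ℝ => (lam * x.1 ^ 2 + c) * fderiv ℝ T (circleMap 0 x.1 x.2) (Complex.exp (x.2 * Complex.I)) := by
    fun_prop
  have hFT : Continuous fun x : ℝ × ℝ => (2 * lam) * (x.1 * T (circleMap 0 x.1 x.2)) := by fun_prop
  set W := ∫ r in a..b, ∫ θ in (-π)..π, ‖fderiv ℝ T (circleMap 0 r θ)‖ * r ^ (p + 1) with hW
  set K := ∫ r in a..b, ∫ θ in (-π)..π, (lam * r ^ 2 + c) * fderiv ℝ T (circleMap 0 r θ) (Complex.exp (θ * Complex.I)) with hK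
  set B := ∫ r in a..b, ∫ θ in (-π)..π, (2 * lam) * (r * T (circleMap 0 r θ)) with hB
  set A := (lam * a ^ 2 + c) * (∫ θ in (-π)..π, T (circleMap 0 a θ)) - (lam * b ^ 2 + c) * (∫ θ in (-π)..π, T (circleMap 0 b θ)) with hAdef
  -- integration by parts
  have hparts : K = - A - B := by
    have h1 : K = ∫ θ in (-π)..π, ((lam * b ^ 2 + c) * T (circleMap 0 b θ) - (lam * a ^ 2 + c) * T (circleMap 0 a θ)
        - ∫ r in a..b, (2 * lam) * (r * T (circleMap 0 r θ))) := by
      rw [hK, hs_swap (F := fun r θ => (lam * r ^ 2 + c) * fderiv ℝ T (circleMap 0 r θ) (Complex.exp (θ * Complex.I))) hFK hab.le hpi]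
      apply intervalIntegral.integral_congr
      intro θ _
      dsimp only
      have hd : ∀ r : ℝ, HasDerivAt (fun r : ℝ => T (circleMap 0 r θ)) (fderiv ℝ T (circleMap 0 r θ) (Complex.exp (θ * Complex.I))) r := by
        intro r
        have : HasDerivAt (fun r : ℝ => circleMap 0 r θ) (Complex.exp (θ * Complex.I)) r := by
          simp only [circleMap_zero]
          simpa using (Complex.ofRealCLM.hasDerivAt (x := r)).mul_const (Complex.exp (θ * Complex.I))
        exact ((hT.differentiable (by norm_num)) _).hasFDerivAt.comp_hasDerivAt r this
      have hkd : ∀ r : ℝ, HasDerivAt (fun r : ℝ => lam * r ^ 2 + c) (2 * lam * r) r := by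
        intro r
        have := ((hasDerivAt_pow 2 r).const_mul lam).add_const c
        refine this.congr_deriv ?_
        norm_num; try ring
      rw [intervalIntegral.integral_mul_deriv_eq_deriv_mul (fun r _ => hkd r) (fun r _ => hd r)
        ((by fun_prop : Continuous fun r : ℝ => 2 * lam * r).intervalIntegrable _ _)
        ((hE.comp (by fun_prop : Continuous fun r : ℝ => (r, θ))).intervalIntegrable _ _)]
      congr 1
      apply intervalIntegral.integral_congr
      intro r _
      dsimp only; ring
    have i1 : ∀ r k : ℝ, IntervalIntegrable (fun θ => k * T (circleMap 0 r θ)) volume (-π) π := fun r k =>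
      (continuous_const.mul (hT2.comp (by fun_prop : Continuous fun θ : ℝ => (r, θ)))).intervalIntegrable _ _
    have hFT' : Continuous fun x : ℝ × ℝ => (2 * lam) * (x.2 * T (circleMap 0 x.2 x.1)) :=
      hFT.comp continuous_swap
    have i2 : IntervalIntegrable (fun θ => ∫ r in a..b, (2 * lam) * (r * T (circleMap 0 r θ))) volume (-π) π :=
      (intervalIntegral.continuous_parametric_intervalIntegral_of_continuous'
        (f := fun θ r => (2 * lam) * (r * T (circleMap 0 r θ))) hFT' a b).intervalIntegrable _ _
    rw [h1, intervalIntegral.integral_sub ((i1 _ _).sub (i1 _ _)) i2, intervalIntegral.integral_sub (i1 _ _) (i1 _ _),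
      intervalIntegral.integral_const_mul, intervalIntegral.integral_const_mul,
      ← hs_swap (F := fun r θ => (2 * lam) * (r * T (circleMap 0 r θ))) hFT hab.le hpi]
    rw [hAdef, hB]; ring
  have hB0 : 0 ≤ B := by
    apply intervalIntegral.integral_nonneg hab.le
    intro r hr
    apply intervalIntegral.integral_nonneg hpi
    intro θ _
    have := hT0 (circleMap 0 r θ)
    have := ha.trans hr.1
    positivity
  -- pointwise in r
  have hG : ∀ r ∈ Set.Ioo a b, 0 ≤ (∫ θ in (-π)..π, ‖fderiv ℝ T (circleMap 0 r θ)‖ * r ^ (p + 1))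
        + (∫ θ in (-π)..π, (lam * r ^ 2 + c) * fderiv ℝ T (circleMap 0 r θ) (Complex.exp (θ * Complex.I))) ∧
      (r ∈ S → 2 * hsZ p lam c r ≤ (∫ θ in (-π)..π, ‖fderiv ℝ T (circleMap 0 r θ)‖ * r ^ (p + 1))
        + (∫ θ in (-π)..π, (lam * r ^ 2 + c) * fderiv ℝ T (circleMap 0 r θ) (Complex.exp (θ * Complex.I)))) := by
    intro r hr
    have hr0 : 0 < r := lt_of_le_of_lt ha hr.1
    have hZ0 : 0 ≤ hsZ p lam c r := by unfold hsZ; positivity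
    have c1 : Continuous fun θ : ℝ => ‖fderiv ℝ T (circleMap 0 r θ)‖ * r ^ (p + 1) :=
      (hfd.comp (continuous_circleMap 0 r)).norm.mul continuous_const
    have c2 : Continuous fun θ : ℝ => (lam * r ^ 2 + c) * fderiv ℝ T (circleMap 0 r θ) (Complex.exp (θ * Complex.I)) :=
      continuous_const.mul ((hfd.comp (continuous_circleMap 0 r)).clm_apply (by fun_prop))
    have c3 : Continuous fun θ : ℝ => hsZ p lam c r * |fderiv ℝ T (circleMap 0 r θ) (circleMap 0 r θ * Complex.I)| := by
      have h2 := continuous_circleMap 0 r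
      have := (hfd.comp h2).clm_apply (by fun_prop : Continuous fun θ : ℝ => circleMap 0 r θ * Complex.I)
      exact continuous_const.mul this.abs
    have hmain : hsZ p lam c r * (∫ θ in (-π)..π, |fderiv ℝ T (circleMap 0 r θ) (circleMap 0 r θ * Complex.I)|) ≤
        (∫ θ in (-π)..π, ‖fderiv ℝ T (circleMap 0 r θ)‖ * r ^ (p + 1))
        + (∫ θ in (-π)..π, (lam * r ^ 2 + c) * fderiv ℝ T (circleMap 0 r θ) (Complex.exp (θ * Complex.I))) := by
      rw [← intervalIntegral.integral_const_mul, ← intervalIntegral.integral_add (c1.intervalIntegrable _ _) (c2.intervalIntegrable _ _)]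
      apply intervalIntegral.integral_mono_on hpi (c3.intervalIntegrable _ _) ((c1.add c2).intervalIntegrable _ _)
      intro θ _
      have := hs_pointwise (D := fderiv ℝ T (circleMap 0 r θ)) (p := p) hr0 (hk r ⟨hr.1.le, hr.2.le⟩) θ
      simp only [Pi.add_apply]
      linarith
    refine ⟨le_trans (mul_nonneg hZ0 (intervalIntegral.integral_nonneg hpi (fun θ _ => abs_nonneg _))) hmain, fun hrS => ?_⟩
    refine le_trans ?_ hmain
    obtain ⟨z₁, z₂, h1, h2, h3, h4⟩ := hS r hrS hr
    have := hs_circleTV hT h1 h2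
    rw [h3, h4] at this
    norm_num at this
    nlinarith
  have cN := hs_cont_param (F := fun r θ => ‖fderiv ℝ T (circleMap 0 r θ)‖ * r ^ (p + 1)) hFN
  have cK := hs_cont_param (F := fun r θ => (lam * r ^ 2 + c) * fderiv ℝ T (circleMap 0 r θ) (Complex.exp (θ * Complex.I))) hFK
  have hGint : ∫ r in a..b, ((∫ θ in (-π)..π, ‖fderiv ℝ T (circleMap 0 r θ)‖ * r ^ (p + 1))
        + (∫ θ in (-π)..π, (lam * r ^ 2 + c) * fderiv ℝ T (circleMap 0 r θ) (Complex.exp (θ * Complex.I)))) = W - A - B := by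
    rw [intervalIntegral.integral_add (cN.intervalIntegrable _ _) (cK.intervalIntegrable _ _), ← hW, ← hK, hparts]; ring
  have hGc : Continuous fun r => (∫ θ in (-π)..π, ‖fderiv ℝ T (circleMap 0 r θ)‖ * r ^ (p + 1))
        + (∫ θ in (-π)..π, (lam * r ^ 2 + c) * fderiv ℝ T (circleMap 0 r θ) (Complex.exp (θ * Complex.I))) := cN.add cK
  have hGof := hs_ofReal_interval hGc hab.le (fun r hr => (hG r hr).1)
  rw [hGint] at hGof
  have hZle : 2 * ∫⁻ r in S ∩ Set.Ioo a b, ENNReal.ofReal (hsZ p lam c r) ≤ ENNReal.ofReal (W - A - B) := by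
    rw [hGof, ← lintegral_const_mul' _ _ (by norm_num)]
    refine le_trans (setLIntegral_mono' (hSm.inter measurableSet_Ioo) (g := fun r => ENNReal.ofReal ((∫ θ in (-π)..π, ‖fderiv ℝ T (circleMap 0 r θ)‖ * r ^ (p + 1))
        + (∫ θ in (-π)..π, (lam * r ^ 2 + c) * fderiv ℝ T (circleMap 0 r θ) (Complex.exp (θ * Complex.I))))) ?_) (lintegral_mono_set Set.inter_subset_right)
    intro r hr
    have := (hG r hr.2).2 hr.1
    refine le_trans (le_of_eq ?_) (ENNReal.ofReal_le_ofReal this)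
    rw [ENNReal.ofReal_mul (by norm_num)]; simp
  have hWAB : 0 ≤ W - A - B := by
    rw [← hGint]
    apply intervalIntegral.integral_nonneg_of_ae_restrict hab.le
    rw [Filter.EventuallyLE, ← MeasureTheory.restrict_Ioo_eq_restrict_Icc]
    filter_upwards [ae_restrict_mem measurableSet_Ioo] with x hx using (hG x hx).1
  have hWeq : ENNReal.ofReal W = ∫⁻ z in {z : ℂ | a < ‖z‖ ∧ ‖z‖ < b}, ENNReal.ofReal (‖fderiv ℝ T z‖ * ‖z‖ ^ p) := by
    apply hs_polar_real (F := fun r θ => ‖fderiv ℝ T (circleMap 0 r θ)‖ * r ^ (p + 1)) hFN ha hab.le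
    · intro r θ hr; positivity
    · exact (hfd.norm.measurable).mul (measurable_norm.pow_const p)
    · intro r θ hr
      rw [norm_circleMap_zero, abs_of_pos hr, rpow_add_one hr.ne']; ring
  have hBle : ENNReal.ofReal (2 * lam) * volume {z : ℂ | (a < ‖z‖ ∧ ‖z‖ < b) ∧ T z = 1} ≤ ENNReal.ofReal B := by
    have e : ENNReal.ofReal B = ∫⁻ z in {z : ℂ | a < ‖z‖ ∧ ‖z‖ < b}, ENNReal.ofReal (2 * lam * T z) := by
      apply hs_polar_real (F := fun r θ => (2 * lam) * (r * T (circleMap 0 r θ))) hFT ha hab.le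
      · intro r θ hr
        have := hT0 (circleMap 0 r θ); positivity
      · fun_prop
      · intro r θ hr; ring
    have hm : MeasurableSet {z : ℂ | (a < ‖z‖ ∧ ‖z‖ < b) ∧ T z = 1} :=
      hs_meas_and hAm (measurableSet_eq_fun (by fun_prop) (by fun_prop))
    rw [e, ← setLIntegral_const]
    refine le_trans (setLIntegral_mono' hm (g := fun z => ENNReal.ofReal (2 * lam * T z)) ?_) (lintegral_mono_set (fun z hz => hz.1))
    intro z hz
    rw [hz.2, mul_one]
  rw [← hWeq]
  calc _ ≤ ENNReal.ofReal A + ENNReal.ofReal B + ENNReal.ofReal (W - A - B) := by gcongr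
    _ = ENNReal.ofReal W := by
      rw [← ENNReal.ofReal_add hA hB0, ← ENNReal.ofReal_add (by positivity) hWAB]; ring_nf

open MeasureTheory Real

structure HsSeq (v : ℂ → ℝ) (s : ℝ) (δ : ℕ → ℝ) (T : ℕ → ℂ → ℝ) : Prop where
  vc : Continuous v
  vs : ∃ R, 0 < R ∧ ∀ z, R ≤ ‖z‖ → v z ≤ s
  dpos : ∀ n, 0 < δ n
  danti : Antitone δ
  dlim : Filter.Tendsto δ Filter.atTop (nhds 0)
  Tc : ∀ n, ContDiff ℝ 1 (T n)
  T0 : ∀ n z, 0 ≤ T n z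
  T1 : ∀ n z, T n z ≤ 1
  Tz : ∀ n z, v z ≤ s → T n z = 0
  To : ∀ n z, s + δ n < v z → T n z = 1

lemma hs_annm (a b : ℝ) : MeasurableSet {z : ℂ | a < ‖z‖ ∧ ‖z‖ < b} :=
  hs_meas_and (measurableSet_lt (by fun_prop) (by fun_prop)) (measurableSet_lt (by fun_prop) (by fun_prop))

lemma hs_mono_lim {α : Type*} [MeasurableSpace α] (μ : Measure α) {δ : ℕ → ℝ} (danti : Antitone δ)
    (dpos : ∀ n, 0 < δ n) (dlim : Filter.Tendsto δ Filter.atTop (nhds 0)) (A : Set α) (s : ℝ) (Q : ℝ → Set α)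
    (hQ : ∀ t, s < t → Q t ⊆ Q s) (hanti : ∀ t t', t ≤ t' → Q t' ⊆ Q t)
    (hex : ∀ x ∈ Q s, ∃ t, s < t ∧ x ∈ Q t) :
    Filter.Tendsto (fun n => μ (Q (s + δ n) ∩ A)) Filter.atTop (nhds (μ (Q s ∩ A))) := by
  have hU : Q s ∩ A = ⋃ n, (Q (s + δ n) ∩ A) := by
    ext x
    simp only [Set.mem_inter_iff, Set.mem_iUnion]
    constructor
    · rintro ⟨h1, h2⟩
      obtain ⟨t, ht, hx⟩ := hex x h1
      obtain ⟨n, hn⟩ := (dlim.eventually (gt_mem_nhds (sub_pos.2 ht))).exists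
      exact ⟨n, hanti _ _ (by linarith) hx, h2⟩
    · rintro ⟨n, h1, h2⟩
      exact ⟨hQ _ (by linarith [dpos n]) h1, h2⟩
  rw [hU]
  apply tendsto_measure_iUnion_atTop
  intro m n hmn
  exact Set.inter_subset_inter_left _ (hanti _ _ (by linarith [danti hmn]))

lemma hs_Hi_open {v : ℂ → ℝ} (vc : Continuous v) (t : ℝ) : IsOpen {r : ℝ | ∃ θ : ℝ, t < v (circleMap 0 r θ)} := by
  have : {r : ℝ | ∃ θ : ℝ, t < v (circleMap 0 r θ)} = ⋃ θ : ℝ, {r : ℝ | t < v (circleMap 0 r θ)} := by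
    ext r; simp
  rw [this]
  apply isOpen_iUnion
  intro θ
  apply isOpen_lt continuous_const
  exact vc.comp (hs_cm_cont.comp (by fun_prop : Continuous fun r : ℝ => (r, θ)))

noncomputable def hsLow (p lam c a b s : ℝ) (v : ℂ → ℝ) (d : ℝ) : ENNReal :=
  ENNReal.ofReal (2 * lam) * volume ({z : ℂ | s + d < v z} ∩ {z : ℂ | a < ‖z‖ ∧ ‖z‖ < b})
    + 2 * ∫⁻ r in {r : ℝ | ∃ θ : ℝ, s + d < v (circleMap 0 r θ)} ∩ Set.Ioo a b, ENNReal.ofReal (hsZ p lam c r)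

lemma hs_Z_meas (p lam c : ℝ) : Measurable (hsZ p lam c) := by
  unfold hsZ; fun_prop

lemma hsLow_tendsto {v : ℂ → ℝ} {s : ℝ} {δ : ℕ → ℝ} {T : ℕ → ℂ → ℝ} (H : HsSeq v s δ T) (p lam c a b : ℝ) :
    Filter.Tendsto (fun n => hsLow p lam c a b s v (δ n)) Filter.atTop (nhds (hsLow p lam c a b s v 0)) := by
  unfold hsLow
  have h1 := hs_mono_lim (volume : Measure ℂ) H.danti H.dpos H.dlim {z : ℂ | a < ‖z‖ ∧ ‖z‖ < b} s
    (fun t => {z : ℂ | t < v z}) (fun t ht z hz => lt_trans ht hz) (fun t t' ht z hz => lt_of_le_of_lt ht hz)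
    (fun z hz => by obtain ⟨t, h1, h2⟩ := exists_between (show s < v z from hz); exact ⟨t, h1, h2⟩)
  have h2 := hs_mono_lim ((volume : Measure ℝ).withDensity (fun r => ENNReal.ofReal (hsZ p lam c r))) H.danti H.dpos H.dlim (Set.Ioo a b) s
    (fun t => {r : ℝ | ∃ θ : ℝ, t < v (circleMap 0 r θ)}) (fun t ht z ⟨θ, hz⟩ => ⟨θ, lt_trans ht hz⟩) (fun t t' ht z ⟨θ, hz⟩ => ⟨θ, lt_of_le_of_lt ht hz⟩)
    (fun z ⟨θ, hz⟩ => by obtain ⟨t, h1, h2⟩ := exists_between hz; exact ⟨t, h1, θ, h2⟩)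
  have h3 : ∀ t, (volume : Measure ℝ).withDensity (fun r => ENNReal.ofReal (hsZ p lam c r)) ({r : ℝ | ∃ θ : ℝ, t < v (circleMap 0 r θ)} ∩ Set.Ioo a b)
      = ∫⁻ r in {r : ℝ | ∃ θ : ℝ, t < v (circleMap 0 r θ)} ∩ Set.Ioo a b, ENNReal.ofReal (hsZ p lam c r) := fun t =>
    withDensity_apply _ ((hs_Hi_open H.vc t).measurableSet.inter measurableSet_Ioo)
  simp only [h3] at h2
  simp only [add_zero]
  exact (ENNReal.Tendsto.const_mul h1 (Or.inr ENNReal.ofReal_ne_top)).add (ENNReal.Tendsto.const_mul h2 (Or.inr (by norm_num)))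

lemma hs_ann_seq {v : ℂ → ℝ} {s : ℝ} {δ : ℕ → ℝ} {T : ℕ → ℂ → ℝ} (H : HsSeq v s δ T) {p lam c a b : ℝ}
    (hp0 : 0 ≤ p) (hl : 0 ≤ lam) (ha : 0 ≤ a) (hab : a < b)
    (hk : ∀ r ∈ Set.Icc a b, |lam * r ^ 2 + c| ≤ r ^ (p + 1))
    (hlo : ∀ r ∈ Set.Ioo a b, ∃ θ : ℝ, v (circleMap 0 r θ) ≤ s) (n : ℕ)
    (hb : ∀ θ : ℝ, v (circleMap 0 b θ) ≤ s)
    (hA : 0 ≤ (lam * a ^ 2 + c) * (∫ θ in (-π)..π, T n (circleMap 0 a θ))) :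
    ENNReal.ofReal ((lam * a ^ 2 + c) * (∫ θ in (-π)..π, T n (circleMap 0 a θ))) + hsLow p lam c a b s v (δ n)
    ≤ ∫⁻ z in {z : ℂ | a < ‖z‖ ∧ ‖z‖ < b}, ENNReal.ofReal (‖fderiv ℝ (T n) z‖ * ‖z‖ ^ p) := by
  have hI : ∫ θ in (-π)..π, T n (circleMap 0 b θ) = 0 := by
    simp [H.Tz n _ (hb _)]
  have := hs_annulus (c := c) hp0 hl ha hab hk (H.Tc n) (H.T0 n) (S := {r : ℝ | ∃ θ : ℝ, s + δ n < v (circleMap 0 r θ)})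
    (hs_Hi_open H.vc _).measurableSet ?_ ?_
  · rw [hI, mul_zero, sub_zero] at this
    refine le_trans ?_ this
    unfold hsLow
    rw [← add_assoc]
    gcongr
    rintro z ⟨h1, h2⟩
    exact ⟨h2, H.To n z h1⟩
  · rintro r ⟨θ, hθ⟩ hr
    obtain ⟨θ', hθ'⟩ := hlo r hr
    have hr0 : 0 ≤ r := ha.trans hr.1.le
    exact ⟨_, _, by rw [norm_circleMap_zero, abs_of_nonneg hr0], by rw [norm_circleMap_zero, abs_of_nonneg hr0], H.To n _ hθ, H.Tz n _ hθ'⟩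
  · rw [hI, mul_zero, sub_zero]; exact hA

lemma hs_ann_vol_lt (a b : ℝ) (E : Set ℂ) : volume (E ∩ {z : ℂ | a < ‖z‖ ∧ ‖z‖ < b}) < ⊤ := by
  refine lt_of_le_of_lt (measure_mono (t := Metric.ball (0:ℂ) b) ?_) measure_ball_lt_top
  rintro z ⟨_, _, h⟩
  simpa using h

lemma hs_pow_half {p Y : ℝ} (hY : 0 ≤ Y) : (√Y) ^ (p + 1) = Y ^ ((p + 1) / 2) := by
  rw [sqrt_eq_rpow, ← rpow_mul hY]; congr 1; ring

/-- components -/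
lemma hs_compB {v : ℂ → ℝ} {s : ℝ} {δ : ℕ → ℝ} {T : ℕ → ℂ → ℝ} (H : HsSeq v s δ T) {p a b : ℝ}
    (hp0 : 0 ≤ p) (hp1 : p ≤ 1) (ha : 0 ≤ a) (hab : a < b)
    (hlo : ∀ r ∈ Set.Ioo a b, ∃ θ : ℝ, v (circleMap 0 r θ) ≤ s)
    (hhi : ∀ r ∈ Set.Ioo a b, ∃ θ : ℝ, s < v (circleMap 0 r θ))
    (haa : ∀ θ : ℝ, v (circleMap 0 a θ) ≤ s) (hb : ∀ θ : ℝ, v (circleMap 0 b θ) ≤ s) :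
    ENNReal.ofReal (2 * π) * (volume ({z : ℂ | s < v z} ∩ {z : ℂ | a < ‖z‖ ∧ ‖z‖ < b}) / ENNReal.ofReal π) ^ ((p + 1) / 2)
      ≤ Filter.liminf (fun n => ∫⁻ z in {z : ℂ | a < ‖z‖ ∧ ‖z‖ < b}, ENNReal.ofReal (‖fderiv ℝ (T n) z‖ * ‖z‖ ^ p)) Filter.atTop := by
  obtain ⟨lam, e, hl, he, hsub, hk⟩ := hs_chordB hp0 hp1 ha hab
  have hI : ∀ n, ∫ θ in (-π)..π, T n (circleMap 0 a θ) = 0 := by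
    intro n; simp [H.Tz n _ (haa _)]
  have h1 : ∀ n, hsLow p lam (-e) a b s v (δ n) ≤ ∫⁻ z in {z : ℂ | a < ‖z‖ ∧ ‖z‖ < b}, ENNReal.ofReal (‖fderiv ℝ (T n) z‖ * ‖z‖ ^ p) := by
    intro n
    have := hs_ann_seq H (c := -e) hp0 hl.le ha hab (fun r hr => by have := hk r hr; rwa [sub_eq_add_neg] at this) hlo n hb (by rw [hI, mul_zero])
    rw [hI, mul_zero] at this
    simpa using this
  have h2 : hsLow p lam (-e) a b s v 0 ≤ Filter.liminf (fun n => ∫⁻ z in {z : ℂ | a < ‖z‖ ∧ ‖z‖ < b}, ENNReal.ofReal (‖fderiv ℝ (T n) z‖ * ‖z‖ ^ p)) Filter.atTop := by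
    rw [← (hsLow_tendsto H p lam (-e) a b).liminf_eq]
    exact Filter.liminf_le_liminf (Filter.Eventually.of_forall h1)
  refine le_trans ?_ h2
  unfold hsLow
  simp only [add_zero]
  have hIntg : {r : ℝ | ∃ θ : ℝ, s < v (circleMap 0 r θ)} ∩ Set.Ioo a b = Set.Ioo a b :=
    Set.inter_eq_right.2 hhi
  rw [hIntg]
  have hfin := hs_ann_vol_lt a b {z : ℂ | s < v z}
  set Y := (volume ({z : ℂ | s < v z} ∩ {z : ℂ | a < ‖z‖ ∧ ‖z‖ < b})).toReal with hY
  have hYe : volume ({z : ℂ | s < v z} ∩ {z : ℂ | a < ‖z‖ ∧ ‖z‖ < b}) = ENNReal.ofReal Y := (ENNReal.ofReal_toReal hfin.ne).symm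
  have hY0 : 0 ≤ Y := ENNReal.toReal_nonneg
  rw [hYe]
  have hYp : 0 ≤ Y / π := by positivity
  have hJ := hs_lemmaJB hp0 hp1 hl he (sqrt_nonneg (Y / π)) hsub
  rw [sq_sqrt hYp, hs_pow_half hYp] at hJ
  rw [← ENNReal.ofReal_div_of_pos pi_pos, ENNReal.ofReal_rpow_of_nonneg hYp (by linarith), ← ENNReal.ofReal_mul (by positivity), ← ENNReal.ofReal_mul (by positivity)]
  calc _ = ENNReal.ofReal (2 * lam * Y + 2 * (π * ((Y / π) ^ ((p + 1) / 2) - lam * (Y / π)))) := by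
        congr 1; field_simp; ring
    _ ≤ ENNReal.ofReal (2 * lam * Y) + ENNReal.ofReal (2 * (π * ((Y / π) ^ ((p + 1) / 2) - lam * (Y / π)))) := ENNReal.ofReal_add_le
    _ ≤ _ := by
        gcongr
        rw [ENNReal.ofReal_mul (by norm_num)]
        simp only [ENNReal.ofReal_ofNat]
        gcongr

open MeasureTheory Real

lemma hs_inner {v : ℂ → ℝ} {s : ℝ} {δ : ℕ → ℝ} {T : ℕ → ℂ → ℝ} (H : HsSeq v s δ T) {p r₁ rs : ℝ}
    (hp0 : 0 ≤ p) (h0 : 0 ≤ r₁) (h1 : r₁ ≤ rs) (hQ : r₁ = 0 ∨ ∀ θ : ℝ, s < v (circleMap 0 r₁ θ)) :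
    ∀ᶠ n in Filter.atTop, ENNReal.ofReal (2 * π * r₁ ^ (p + 1)) ≤
      ENNReal.ofReal (rs ^ (p + 1) * (∫ θ in (-π)..π, T n (circleMap 0 rs θ)))
      + ∫⁻ z in {z : ℂ | r₁ < ‖z‖ ∧ ‖z‖ < rs}, ENNReal.ofReal (‖fderiv ℝ (T n) z‖ * ‖z‖ ^ p) := by
  have hpi : -π ≤ π := by linarith [pi_pos]
  have hcirc : ∀ r, Continuous fun θ : ℝ => circleMap 0 r θ := fun r => continuous_circleMap 0 r
  rcases hQ with rfl | hQ
  · refine Filter.Eventually.of_forall fun n => ?_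
    rw [zero_rpow (by linarith)]; simp
  have hev : ∀ᶠ n in Filter.atTop, ∀ θ ∈ Set.Icc (-π) π, T n (circleMap 0 r₁ θ) = 1 := by
    obtain ⟨θ₀, _, hmin⟩ := isCompact_Icc.exists_isMinOn (Set.nonempty_Icc.2 hpi) ((H.vc.comp (hcirc r₁)).continuousOn)
    have : 0 < v (circleMap 0 r₁ θ₀) - s := sub_pos.2 (hQ θ₀)
    filter_upwards [H.dlim.eventually (gt_mem_nhds this)] with n hn θ hθ
    apply H.To
    have : v (circleMap 0 r₁ θ₀) ≤ v (circleMap 0 r₁ θ) := hmin hθ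
    linarith
  filter_upwards [hev] with n hn
  have hI1 : ∫ θ in (-π)..π, T n (circleMap 0 r₁ θ) = 2 * π := by
    have : ∫ θ in (-π)..π, T n (circleMap 0 r₁ θ) = ∫ θ in (-π)..π, (1:ℝ) := by
      apply intervalIntegral.integral_congr
      intro θ hθ
      rw [Set.uIcc_of_le hpi] at hθ
      exact hn θ hθ
    rw [this]; simp; ring
  set I := ∫ θ in (-π)..π, T n (circleMap 0 rs θ) with hI
  have hI0 : 0 ≤ I := intervalIntegral.integral_nonneg hpi (fun θ _ => H.T0 n _)
  have hI2 : I ≤ 2 * π := by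
    have : I ≤ ∫ θ in (-π)..π, (1:ℝ) := by
      apply intervalIntegral.integral_mono_on hpi
      · exact (((H.Tc n).continuous.comp (hcirc rs))).intervalIntegrable _ _
      · exact continuous_const.intervalIntegrable _ _
      · intro θ _; exact H.T1 n _
    refine this.trans (le_of_eq ?_)
    simp; ring
  have hP : 0 ≤ r₁ ^ (p + 1) := by positivity
  rcases h1.eq_or_lt with rfl | h1
  · refine le_trans (ENNReal.ofReal_le_ofReal ?_) le_self_add
    rw [hI, hI1]; linarith
  have hpow : r₁ ^ (p + 1) ≤ rs ^ (p + 1) := by gcongr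
  have hA := hs_annulus (p := p) (lam := 0) (c := r₁ ^ (p + 1)) hp0 le_rfl h0 h1 (by
      intro r hr
      rw [zero_mul, zero_add, abs_of_nonneg hP]
      have := hr.1
      gcongr) (H.Tc n) (H.T0 n) (S := ∅) MeasurableSet.empty (by simp) (by
      rw [← hI, hI1]; nlinarith)
  rw [← hI, hI1] at hA
  have : ENNReal.ofReal (2 * π * r₁ ^ (p + 1)) ≤ ENNReal.ofReal (rs ^ (p + 1) * I) + ENNReal.ofReal ((0 * r₁ ^ 2 + r₁ ^ (p + 1)) * (2 * π) - (0 * rs ^ 2 + r₁ ^ (p + 1)) * I) := by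
    refine le_trans (ENNReal.ofReal_le_ofReal ?_) ENNReal.ofReal_add_le
    nlinarith
  refine this.trans ?_
  gcongr
  refine le_trans ?_ hA
  rw [add_assoc]
  exact le_self_add

lemma hs_J_union (f : ℂ → ENNReal) {a b c : ℝ} (hbc : b ≤ c) :
    (∫⁻ z in {z : ℂ | a < ‖z‖ ∧ ‖z‖ < b}, f z) + (∫⁻ z in {z : ℂ | b < ‖z‖ ∧ ‖z‖ < c}, f z) ≤
      ∫⁻ z in {z : ℂ | ‖z‖ < c}, f z := by
  rw [← lintegral_union (hs_annm b c)]
  · apply lintegral_mono_set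
    rintro z (⟨_, h⟩ | ⟨_, h⟩)
    · exact lt_of_lt_of_le h hbc
    · exact h
  · rw [Set.disjoint_left]
    rintro z ⟨_, h1⟩ ⟨h2, _⟩
    exact lt_asymm h1 h2

lemma hs_disc {v : ℂ → ℝ} {s : ℝ} {δ : ℕ → ℝ} {T : ℕ → ℂ → ℝ} (H : HsSeq v s δ T) {p : ℝ}
    (hp0 : 0 ≤ p) (hp1 : p ≤ 1) : ∃ b : ℝ, 0 ≤ b ∧ (∀ θ : ℝ, v (circleMap 0 b θ) ≤ s) ∧
      (∀ r, b < r → ∃ θ : ℝ, v (circleMap 0 r θ) ≤ s) ∧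
      ENNReal.ofReal (2 * π) * (volume ({z : ℂ | s < v z} ∩ {z : ℂ | ‖z‖ < b}) / ENNReal.ofReal π) ^ ((p + 1) / 2)
      ≤ Filter.liminf (fun n => ∫⁻ z in {z : ℂ | ‖z‖ < b}, ENNReal.ofReal (‖fderiv ℝ (T n) z‖ * ‖z‖ ^ p)) Filter.atTop := by
  obtain ⟨R, hR0, hR⟩ := H.vs
  have hpi : -π ≤ π := by linarith [pi_pos]
  have hRc : ∀ r θ, R ≤ r → v (circleMap 0 r θ) ≤ s := by
    intro r θ h
    apply hR
    rw [norm_circleMap_zero]; exact h.trans (le_abs_self r)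
  set Q : Set ℝ := {r | 0 ≤ r ∧ (r = 0 ∨ ∀ θ : ℝ, s < v (circleMap 0 r θ))} with hQ
  have hQ0 : (0 : ℝ) ∈ Q := ⟨le_rfl, Or.inl rfl⟩
  have hQb : BddAbove Q := by
    refine ⟨R, ?_⟩
    rintro r ⟨_, h | h⟩
    · rw [h]; exact hR0.le
    · by_contra hc
      push Not at hc
      exact absurd (h 0) (not_lt.2 (hRc r 0 hc.le))
  set rs := sSup Q with hrs
  have hrs0 : 0 ≤ rs := le_csSup hQb hQ0
  set B : Set ℝ := {r | rs ≤ r ∧ ∀ θ : ℝ, v (circleMap 0 r θ) ≤ s} with hB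
  have hBne : B.Nonempty := ⟨max rs R, le_max_left _ _, fun θ => hRc _ θ (le_max_right _ _)⟩
  have hBc : IsClosed B := by
    have : B = Set.Ici rs ∩ ⋂ θ : ℝ, {r : ℝ | v (circleMap 0 r θ) ≤ s} := by
      ext r; simp [hB]
    rw [this]
    refine isClosed_Ici.inter (isClosed_iInter fun θ => ?_)
    apply isClosed_le _ continuous_const
    exact H.vc.comp (hs_cm_cont.comp (by fun_prop : Continuous fun r : ℝ => (r, θ)))
  have hBb : BddBelow B := ⟨rs, fun r hr => hr.1⟩
  set b := sInf B with hb
  have hbB : b ∈ B := hBc.csInf_mem hBne hBb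
  have hlo : ∀ r, rs < r → ∃ θ : ℝ, v (circleMap 0 r θ) ≤ s := by
    intro r hr
    by_contra hc
    push Not at hc
    exact absurd (le_csSup hQb (show r ∈ Q from ⟨hrs0.trans hr.le, Or.inr hc⟩)) (not_le.2 hr)
  have hhi : ∀ r ∈ Set.Ioo rs b, ∃ θ : ℝ, s < v (circleMap 0 r θ) := by
    intro r hr
    by_contra hc
    push Not at hc
    exact absurd (csInf_le hBb (show r ∈ B from ⟨hr.1.le, hc⟩)) (not_le.2 hr.2)
  refine ⟨b, hrs0.trans hbB.1, hbB.2, fun r hr => hlo r (lt_of_le_of_lt hbB.1 hr), ?_⟩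
  -- limit in r1
  have hlim : ∀ (M L : ENNReal), (∀ r₁ ∈ Q, ENNReal.ofReal (2 * π * r₁ ^ (p + 1)) + M ≤ L) →
      ENNReal.ofReal (2 * π * rs ^ (p + 1)) + M ≤ L := by
    intro M L h
    obtain ⟨x, _, hx, hxQ⟩ := exists_seq_tendsto_sSup ⟨0, hQ0⟩ hQb
    have hc : Continuous fun r : ℝ => 2 * π * r ^ (p + 1) := continuous_const.mul (Real.continuous_rpow_const (by linarith))
    have ht := (ENNReal.tendsto_ofReal ((hc.tendsto (sSup Q)).comp hx)).add_const M
    exact le_of_tendsto' ht (fun n => h _ (hxQ n))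
  have hball : volume ({z : ℂ | s < v z} ∩ {z : ℂ | ‖z‖ < b}) ≤
      ENNReal.ofReal (π * rs ^ 2) + volume ({z : ℂ | s < v z} ∩ {z : ℂ | rs < ‖z‖ ∧ ‖z‖ < b}) := by
    have hsub : ({z : ℂ | s < v z} ∩ {z : ℂ | ‖z‖ < b}) ⊆ Metric.closedBall 0 rs ∪ ({z : ℂ | s < v z} ∩ {z : ℂ | rs < ‖z‖ ∧ ‖z‖ < b}) := by
      rintro z ⟨h1, h2⟩
      rcases le_or_gt ‖z‖ rs with h | h
      · left; simpa using h
      · right; exact ⟨h1, h, h2⟩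
    refine (measure_mono hsub).trans ((measure_union_le _ _).trans ?_)
    gcongr
    rw [Complex.volume_closedBall, ENNReal.ofReal_mul pi_pos.le, ENNReal.ofReal_pow hrs0, mul_comm]
    apply le_of_eq; congr 1
    rw [ENNReal.ofReal]; congr 1
    ext; simp [pi_pos.le]
  rcases hbB.1.eq_or_lt with hrb | hrb
  · -- degenerate annulus
    have hI : ∀ n, ∫ θ in (-π)..π, T n (circleMap 0 rs θ) = 0 := by
      intro n; rw [hrb]; simp [H.Tz n _ (hbB.2 _)]
    have h1 := hlim 0 (Filter.liminf (fun n => ∫⁻ z in {z : ℂ | ‖z‖ < b}, ENNReal.ofReal (‖fderiv ℝ (T n) z‖ * ‖z‖ ^ p)) Filter.atTop) (by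
      intro r₁ hr₁
      rw [add_zero]
      refine Filter.le_liminf_of_le (by isBoundedDefault) ?_
      filter_upwards [hs_inner H hp0 hr₁.1 (le_csSup hQb hr₁) hr₁.2] with n hn
      rw [hI, mul_zero, ENNReal.ofReal_zero, zero_add] at hn
      refine hn.trans (lintegral_mono_set ?_)
      rintro z ⟨_, h⟩
      exact lt_of_lt_of_eq h hrb)
    rw [add_zero] at h1
    refine le_trans ?_ h1
    have hemp : ({z : ℂ | s < v z} ∩ {z : ℂ | rs < ‖z‖ ∧ ‖z‖ < b}) = ∅ := by
      ext z; simp only [Set.mem_inter_iff, Set.mem_ofPred_eq, Set.mem_empty_iff_false, iff_false]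
      rintro ⟨_, h1, h2⟩; linarith
    rw [hemp, measure_empty, add_zero] at hball
    calc _ ≤ ENNReal.ofReal (2 * π) * (ENNReal.ofReal (π * rs ^ 2) / ENNReal.ofReal π) ^ ((p + 1) / 2) := by gcongr
      _ = _ := by
        rw [← ENNReal.ofReal_div_of_pos pi_pos, show π * rs ^ 2 / π = rs ^ 2 by field_simp, ENNReal.ofReal_rpow_of_nonneg (by positivity) (by linarith),
          ← hs_pow_half (by positivity), sqrt_sq hrs0, ← ENNReal.ofReal_mul (by positivity)]
  · obtain ⟨lam, c, hl, hc0, hca, hcb, hsub, hk⟩ := hs_chordA hp0 hp1 hrs0 hrb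
    have hst : ∀ r₁ ∈ Q, ENNReal.ofReal (2 * π * r₁ ^ (p + 1)) + hsLow p lam c rs b s v 0 ≤
        Filter.liminf (fun n => ∫⁻ z in {z : ℂ | ‖z‖ < b}, ENNReal.ofReal (‖fderiv ℝ (T n) z‖ * ‖z‖ ^ p)) Filter.atTop := by
      intro r₁ hr₁
      have ht := (hsLow_tendsto H p lam c rs b).const_add (ENNReal.ofReal (2 * π * r₁ ^ (p + 1)))
      rw [← ht.liminf_eq]
      refine Filter.liminf_le_liminf ?_
      filter_upwards [hs_inner H hp0 hr₁.1 (le_csSup hQb hr₁) hr₁.2] with n hn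
      have h2 := hs_ann_seq H (c := c) hp0 hl.le hrs0 hrb hk (fun r hr => hlo r hr.1) n hbB.2 (by
        rw [hca]
        exact mul_nonneg (by positivity) (intervalIntegral.integral_nonneg hpi (fun θ _ => H.T0 n _)))
      rw [hca] at h2
      refine le_trans ?_ (hs_J_union (a := r₁) _ hrb.le)
      calc _ ≤ _ := add_le_add_left hn _
        _ = _ := by rw [add_comm (ENNReal.ofReal _) (lintegral _ _), add_assoc]
        _ ≤ _ := add_le_add_right h2 _
    have h1 := hlim _ _ hst
    refine le_trans ?_ h1
    unfold hsLow
    simp only [add_zero]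
    have hIntg : {r : ℝ | ∃ θ : ℝ, s < v (circleMap 0 r θ)} ∩ Set.Ioo rs b = Set.Ioo rs b :=
      Set.inter_eq_right.2 hhi
    rw [hIntg]
    have hfin := hs_ann_vol_lt rs b {z : ℂ | s < v z}
    set Y := (volume ({z : ℂ | s < v z} ∩ {z : ℂ | rs < ‖z‖ ∧ ‖z‖ < b})).toReal with hY
    have hYe : volume ({z : ℂ | s < v z} ∩ {z : ℂ | rs < ‖z‖ ∧ ‖z‖ < b}) = ENNReal.ofReal Y := (ENNReal.ofReal_toReal hfin.ne).symm
    have hY0 : 0 ≤ Y := ENNReal.toReal_nonneg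
    rw [hYe] at hball ⊢
    have hXp : 0 ≤ rs ^ 2 + Y / π := by positivity
    have hJ := hs_lemmaJA hp0 hp1 hl hc0 (sqrt_nonneg (rs ^ 2 + Y / π)) hrs0 hsub
    rw [sq_sqrt hXp, hs_pow_half hXp] at hJ
    rw [← ENNReal.ofReal_add (by positivity) hY0] at hball
    calc _ ≤ ENNReal.ofReal (2 * π) * (ENNReal.ofReal (π * rs ^ 2 + Y) / ENNReal.ofReal π) ^ ((p + 1) / 2) := by gcongr
      _ = ENNReal.ofReal (2 * π * (rs ^ 2 + Y / π) ^ ((p + 1) / 2)) := by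
        rw [← ENNReal.ofReal_div_of_pos pi_pos, show (π * rs ^ 2 + Y) / π = rs ^ 2 + Y / π by field_simp, ENNReal.ofReal_rpow_of_nonneg (by positivity) (by linarith),
          ← ENNReal.ofReal_mul (by positivity)]
      _ = ENNReal.ofReal (2 * π * rs ^ (p + 1) + (2 * lam * Y + 2 * (π * ((rs ^ 2 + Y / π) ^ ((p + 1) / 2) - lam * (rs ^ 2 + Y / π) - c)))) := by
        congr 1; rw [← hca]; field_simp; ring
      _ ≤ ENNReal.ofReal (2 * π * rs ^ (p + 1)) + (ENNReal.ofReal (2 * lam * Y) + ENNReal.ofReal (2 * (π * ((rs ^ 2 + Y / π) ^ ((p + 1) / 2) - lam * (rs ^ 2 + Y / π) - c)))) :=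
        ENNReal.ofReal_add_le.trans (by gcongr; exact ENNReal.ofReal_add_le)
      _ ≤ _ := by
        rw [ENNReal.ofReal_mul (p := 2 * lam) (by positivity)]
        gcongr
        rw [ENNReal.ofReal_mul (by norm_num)]
        simp only [ENNReal.ofReal_ofNat]
        gcongr

open MeasureTheory Real

lemma hs_rpow_tsum {ι : Type*} (X : ι → ENNReal) {q : ℝ} (hq : 0 < q) (hq1 : q ≤ 1) :
    (∑' i, X i) ^ q ≤ ∑' i, X i ^ q := by
  have hfin : ∀ F : Finset ι, (∑ i ∈ F, X i) ^ q ≤ ∑ i ∈ F, X i ^ q := by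
    classical
    intro F
    induction F using Finset.induction_on with
    | empty => simp [ENNReal.zero_rpow_of_pos hq]
    | insert a F ha ih =>
      rw [Finset.sum_insert ha, Finset.sum_insert ha]
      exact (ENNReal.rpow_add_le_add_rpow _ _ hq.le hq1).trans (by gcongr)
  have ht : Filter.Tendsto (fun F : Finset ι => (∑ i ∈ F, X i) ^ q) Filter.atTop (nhds ((∑' i, X i) ^ q)) :=
    ((ENNReal.continuous_rpow_const).tendsto _).comp (ENNReal.summable.hasSum)
  exact le_of_tendsto' ht (fun F => (hfin F).trans (ENNReal.sum_le_tsum F))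

lemma hs_liminf_tsum {ι : Type*} [Countable ι] (f : ℕ → ι → ENNReal) :
    ∑' i, Filter.liminf (fun n => f n i) Filter.atTop ≤ Filter.liminf (fun n => ∑' i, f n i) Filter.atTop := by
  let _ : MeasurableSpace ι := ⊤
  have := lintegral_liminf_le (μ := (Measure.count : Measure ι)) (u := Filter.atTop) (f := f) (fun n => measurable_from_top)
  simpa only [lintegral_count] using this

lemma hs_sum {ι : Type*} [Countable ι] (A : ι → Set ℂ) (hm : ∀ i, MeasurableSet (A i))
    (hd : Pairwise (Function.onFun Disjoint A)) (E : Set ℂ) (hE : E ⊆ ⋃ i, A i) (K c : ENNReal) (f : ℕ → ℂ → ENNReal)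
    {q : ℝ} (hq : 0 < q) (hq1 : q ≤ 1)
    (h : ∀ i, K * (volume (E ∩ A i) / c) ^ q ≤ Filter.liminf (fun n => ∫⁻ z in A i, f n z) Filter.atTop) :
    K * (volume E / c) ^ q ≤ Filter.liminf (fun n => ∫⁻ z, f n z) Filter.atTop := by
  have h1 : volume E ≤ ∑' i, volume (E ∩ A i) := by
    refine le_trans (measure_mono ?_) (measure_iUnion_le _)
    rw [← Set.inter_iUnion]
    exact Set.subset_inter le_rfl hE
  calc K * (volume E / c) ^ q ≤ K * (∑' i, volume (E ∩ A i) / c) ^ q := by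
        gcongr
        simp only [div_eq_mul_inv]
        rw [ENNReal.tsum_mul_right]
        gcongr
    _ ≤ K * ∑' i, (volume (E ∩ A i) / c) ^ q := by gcongr; exact hs_rpow_tsum _ hq hq1
    _ = ∑' i, K * (volume (E ∩ A i) / c) ^ q := ENNReal.tsum_mul_left.symm
    _ ≤ ∑' i, Filter.liminf (fun n => ∫⁻ z in A i, f n z) Filter.atTop := ENNReal.tsum_le_tsum h
    _ ≤ Filter.liminf (fun n => ∑' i, ∫⁻ z in A i, f n z) Filter.atTop := hs_liminf_tsum _
    _ ≤ _ := by
        refine Filter.liminf_le_liminf (Filter.Eventually.of_forall fun n => ?_)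
        rw [← lintegral_iUnion hm hd]
        exact setLIntegral_le_lintegral _ _

lemma hs_component {U : Set ℝ} (hU : IsOpen U) {m M : ℝ} (hb : U ⊆ Set.Icc m M) {x : ℝ} (hx : x ∈ U) :
    ∃ a b, a < b ∧ connectedComponentIn U x = Set.Ioo a b ∧ a ∉ U ∧ b ∉ U := by
  set C := connectedComponentIn U x with hC
  have hCo : IsOpen C := hU.connectedComponentIn
  have hxC : x ∈ C := mem_connectedComponentIn hx
  have hCU : C ⊆ U := connectedComponentIn_subset U x
  have hcon : IsConnected C := ⟨⟨x, hxC⟩, isPreconnected_connectedComponentIn⟩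
  have hbb : BddBelow C := ⟨m, fun y hy => (hb (hCU hy)).1⟩
  have hba : BddAbove C := ⟨M, fun y hy => (hb (hCU hy)).2⟩
  have hmem : ∀ y ∈ C, sInf C < y ∧ y < sSup C := by
    intro y hy
    obtain ⟨ε, hε, hball⟩ := Metric.isOpen_iff.1 hCo y hy
    have h1 : y - ε / 2 ∈ C := hball (by rw [Metric.mem_ball, Real.dist_eq]; rw [show y - ε / 2 - y = -(ε / 2) by ring, abs_neg, abs_of_pos (by positivity)]; linarith)
    have h2 : y + ε / 2 ∈ C := hball (by rw [Metric.mem_ball, Real.dist_eq]; rw [show y + ε / 2 - y = (ε / 2) by ring, abs_of_pos (by positivity)]; linarith)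
    have := csInf_le hbb h1
    have := le_csSup hba h2
    constructor <;> linarith
  have hIoo : C = Set.Ioo (sInf C) (sSup C) :=
    Set.Subset.antisymm (fun y hy => hmem y hy) (hcon.Ioo_csInf_csSup_subset hbb hba)
  have hlt : sInf C < sSup C := (hmem x hxC).1.trans (hmem x hxC).2
  have hend : ∀ e ∈ U, e ∈ closure C → e ∈ C := by
    intro e he hcl
    obtain ⟨y, hy1, hy2⟩ := mem_closure_iff.1 hcl _ (hU.connectedComponentIn (x := e)) (mem_connectedComponentIn he)
    have e1 := connectedComponentIn_eq hy1
    have e2 := connectedComponentIn_eq (show y ∈ connectedComponentIn U x from hy2)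
    rw [hC, e2, ← e1]
    exact mem_connectedComponentIn he
  refine ⟨sInf C, sSup C, hlt, hIoo, fun h => ?_, fun h => ?_⟩
  · exact lt_irrefl _ (hmem _ (hend _ h (csInf_mem_closure ⟨x, hxC⟩ hbb))).1
  · exact lt_irrefl _ (hmem _ (hend _ h (csSup_mem_closure ⟨x, hxC⟩ hba))).2

lemma hs_level {v : ℂ → ℝ} {s : ℝ} {δ : ℕ → ℝ} {T : ℕ → ℂ → ℝ} (H : HsSeq v s δ T) {p : ℝ}
    (hp0 : 0 ≤ p) (hp1 : p ≤ 1) :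
    ENNReal.ofReal (2 * π) * (volume {z : ℂ | s < v z} / ENNReal.ofReal π) ^ ((p + 1) / 2)
      ≤ Filter.liminf (fun n => ∫⁻ z, ENNReal.ofReal (‖fderiv ℝ (T n) z‖ * ‖z‖ ^ p)) Filter.atTop := by
  obtain ⟨b, hb0, hbs, hlo, hdisc⟩ := hs_disc H hp0 hp1
  obtain ⟨R, hR0, hR⟩ := H.vs
  set U : Set ℝ := {r : ℝ | ∃ θ : ℝ, s < v (circleMap 0 r θ)} ∩ Set.Ioi b with hUdef
  have hU : IsOpen U := (hs_Hi_open H.vc s).inter isOpen_Ioi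
  have hUb : U ⊆ Set.Icc b R := by
    rintro r ⟨⟨θ, hθ⟩, hr⟩
    refine ⟨le_of_lt hr, ?_⟩
    by_contra hc
    push Not at hc
    refine absurd hθ (not_lt.2 (hR _ ?_))
    rw [norm_circleMap_zero]; exact hc.le.trans (le_abs_self r)
  set 𝒞 : Set (Set ℝ) := {C | ∃ q : ℚ, (q : ℝ) ∈ U ∧ C = connectedComponentIn U q} with h𝒞
  have hcount : 𝒞.Countable := by
    refine (Set.countable_range (fun q : ℚ => connectedComponentIn U (q : ℝ))).mono ?_
    rintro C ⟨q, _, rfl⟩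
    exact ⟨q, rfl⟩
  have : Countable 𝒞 := hcount.to_subtype
  have hnotU : ∀ e, b ≤ e → e ∉ U → ∀ θ : ℝ, v (circleMap 0 e θ) ≤ s := by
    intro e he hn θ
    rcases he.eq_or_lt with rfl | he
    · exact hbs θ
    · by_contra hc
      push Not at hc
      exact hn ⟨⟨θ, hc⟩, he⟩
  have hCU : ∀ C ∈ 𝒞, C ⊆ U := by
    rintro C ⟨q, _, rfl⟩; exact connectedComponentIn_subset _ _
  have hCopen : ∀ C ∈ 𝒞, IsOpen C := by
    rintro C ⟨q, _, rfl⟩; exact hU.connectedComponentIn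
  have hCdisj : ∀ C ∈ 𝒞, ∀ D ∈ 𝒞, ∀ y, y ∈ C → y ∈ D → C = D := by
    rintro C ⟨q, _, rfl⟩ D ⟨q', _, rfl⟩ y h1 h2
    rw [connectedComponentIn_eq h1, connectedComponentIn_eq h2]
  have hcover : ∀ r ∈ U, ∃ C ∈ 𝒞, r ∈ C := by
    intro r hr
    have ho : IsOpen (connectedComponentIn U r) := hU.connectedComponentIn
    obtain ⟨q, hq⟩ := Rat.isDenseEmbedding_coe_real.dense.exists_mem_open ho ⟨r, mem_connectedComponentIn hr⟩
    refine ⟨_, ⟨q, connectedComponentIn_subset _ _ hq, rfl⟩, ?_⟩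
    rw [← connectedComponentIn_eq hq]
    exact mem_connectedComponentIn hr
  let A : Option 𝒞 → Set ℂ := fun o => match o with
    | none => {z : ℂ | ‖z‖ < b}
    | some C => {z : ℂ | ‖z‖ ∈ C.1}
  refine hs_sum A ?_ ?_ _ ?_ _ _ _ (by linarith) (by linarith) ?_
  · rintro (_ | C)
    · exact measurableSet_lt (by fun_prop) (by fun_prop)
    · exact measurable_norm (hCopen C.1 C.2).measurableSet
  · have hnone : ∀ C : 𝒞, Disjoint (A none) (A (some C)) := by
      intro C
      rw [Set.disjoint_left]
      intro z h1 h2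
      exact lt_asymm (show ‖z‖ < b from h1) (hCU C.1 C.2 h2).2
    rintro (_ | C) (_ | D) hne
    · exact absurd rfl hne
    · exact hnone D
    · exact (hnone C).symm
    · rw [Function.onFun, Set.disjoint_left]
      intro z h1 h2
      exact hne (congrArg some (Subtype.ext (hCdisj _ C.2 _ D.2 _ h1 h2)))
  · intro z hz
    have harg : circleMap 0 ‖z‖ (Complex.arg z) = z := by rw [circleMap_zero, Complex.norm_mul_exp_arg_mul_I]
    rw [Set.mem_iUnion]
    rcases lt_trichotomy ‖z‖ b with h | h | h
    · exact ⟨none, h⟩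
    · exfalso
      have := hbs (Complex.arg z)
      rw [← h, harg] at this
      exact absurd hz (not_lt.2 this)
    · obtain ⟨C, hC, hzC⟩ := hcover ‖z‖ ⟨⟨Complex.arg z, by rw [harg]; exact hz⟩, h⟩
      exact ⟨some ⟨C, hC⟩, hzC⟩
  · rintro (_ | ⟨C, hC⟩)
    · exact hdisc
    · obtain ⟨q, hq, hCq⟩ := hC
      obtain ⟨a', b', hab, hIoo, ha', hb'⟩ := hs_component hU hUb hq
      have hA : A (some ⟨C, ⟨q, hq, hCq⟩⟩) = {z : ℂ | a' < ‖z‖ ∧ ‖z‖ < b'} := by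
        show {z : ℂ | ‖z‖ ∈ C} = _
        rw [hCq, hIoo]; rfl
      rw [hA]
      have hsubU : Set.Ioo a' b' ⊆ U := by rw [← hIoo]; exact connectedComponentIn_subset _ _
      have hba : b ≤ a' := by
        by_contra hc
        push Not at hc
        obtain ⟨y, hy1, hy2⟩ := exists_between (lt_min hc hab)
        have := (hsubU ⟨hy1, hy2.trans_le (min_le_right _ _)⟩).2
        exact lt_asymm this (hy2.trans_le (min_le_left _ _))
      exact hs_compB H hp0 hp1 (hb0.trans hba) hab (fun r hr => hlo r (lt_of_le_of_lt hba hr.1)) (fun r hr => (hsubU hr).1)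
        (hnotU a' hba ha') (hnotU b' (hba.trans hab.le) hb')

open MeasureTheory Real

noncomputable def hsg (x : ℝ) : ℝ := deriv smoothTransition x

lemma hsg_cont : Continuous hsg :=
  (smoothTransition.contDiff (n := 1)).continuous_deriv (by norm_num)

lemma hsg_nonneg (x : ℝ) : 0 ≤ hsg x := smoothTransition.monotone.deriv_nonneg

lemma hsg_hasDeriv (x : ℝ) : HasDerivAt smoothTransition (hsg x) x :=
  (((smoothTransition.contDiff (n := 1)).differentiable (by norm_num)) x).hasDerivAt

/-- truncation at level `s` -/
noncomputable def hsChi (s d y : ℝ) : ℝ := smoothTransition ((y - s) / d) + smoothTransition ((-y - s) / d)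

noncomputable def hsHd (d s y : ℝ) : ℝ := (hsg ((y - s) / d) + hsg ((-y - s) / d)) / d

lemma hsChi_contDiff (s d : ℝ) : ContDiff ℝ 1 (hsChi s d) := by
  unfold hsChi
  apply ContDiff.add
  · exact (smoothTransition.contDiff (n := 1)).comp (by fun_prop)
  · exact (smoothTransition.contDiff (n := 1)).comp (by fun_prop)

lemma hsChi_deriv (s d y : ℝ) : HasDerivAt (hsChi s d) ((hsg ((y - s) / d) - hsg ((-y - s) / d)) / d) y := by
  have h1 : HasDerivAt (fun y : ℝ => (y - s) / d) (1 / d) y := ((hasDerivAt_id y).sub_const s).div_const d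
  have h2 : HasDerivAt (fun y : ℝ => (-y - s) / d) (-1 / d) y := ((hasDerivAt_id y).neg.sub_const s).div_const d
  have := ((hsg_hasDeriv _).comp y h1).add ((hsg_hasDeriv _).comp y h2)
  refine HasDerivAt.congr_deriv this ?_
  ring

lemma hsChi_seq {w : ℂ → ℝ} (hw : ContDiff ℝ 1 w) (hc : HasCompactSupport w) {s : ℝ} (hs : 0 < s) :
    HsSeq (fun z => |w z|) s (fun n : ℕ => 1 / ((n : ℝ) + 1)) (fun n z => hsChi s (1 / ((n : ℝ) + 1)) (w z)) := by
  have hd : ∀ n : ℕ, 0 < 1 / ((n : ℝ) + 1) := fun n => by positivity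
  refine ⟨hw.continuous.abs, ?_, hd, ?_, tendsto_one_div_add_atTop_nhds_zero_nat, ?_, ?_, ?_, ?_, ?_⟩
  · obtain ⟨R, hR⟩ := hc.isCompact.isBounded.subset_closedBall (0 : ℂ)
    refine ⟨max R 0 + 1, by positivity, fun z hz => ?_⟩
    have : w z = 0 := by
      apply image_eq_zero_of_notMem_tsupport
      intro h
      have := hR h
      rw [mem_closedBall_zero_iff] at this
      have := le_max_left R 0
      linarith
    rw [this]; simpa using hs.le
  · intro m n h
    dsimp only
    gcongr
  · intro n; exact (hsChi_contDiff _ _).comp hw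
  · intro n z
    exact add_nonneg (smoothTransition.nonneg _) (smoothTransition.nonneg _)
  · intro n z
    unfold hsChi
    rcases le_total 0 (w z) with h | h
    · rw [smoothTransition.zero_of_nonpos (x := (-w z - s) / _) (div_nonpos_of_nonpos_of_nonneg (by linarith) (hd n).le), add_zero]
      exact smoothTransition.le_one _
    · rw [smoothTransition.zero_of_nonpos (x := (w z - s) / _) (div_nonpos_of_nonpos_of_nonneg (by linarith) (hd n).le), zero_add]
      exact smoothTransition.le_one _
  · intro n z h
    unfold hsChi
    have := abs_le.1 h
    rw [smoothTransition.zero_of_nonpos (x := (-w z - s) / _) (div_nonpos_of_nonpos_of_nonneg (by linarith) (hd n).le),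
      smoothTransition.zero_of_nonpos (x := (w z - s) / _) (div_nonpos_of_nonpos_of_nonneg (by linarith) (hd n).le), add_zero]
  · intro n z h
    unfold hsChi
    have hdn := hd n
    rcases le_total 0 (w z) with h' | h'
    · rw [abs_of_nonneg h'] at h
      rw [smoothTransition.zero_of_nonpos (x := (-w z - s) / _) (div_nonpos_of_nonpos_of_nonneg (by linarith) (hd n).le), add_zero]
      apply smoothTransition.one_of_one_le
      rw [le_div_iff₀ hdn]; linarith
    · rw [abs_of_nonpos h'] at h
      rw [smoothTransition.zero_of_nonpos (x := (w z - s) / _) (div_nonpos_of_nonpos_of_nonneg (by linarith) (hd n).le), zero_add]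
      apply smoothTransition.one_of_one_le
      rw [le_div_iff₀ hdn]; linarith

lemma hsHd_nonneg {d : ℝ} (hd : 0 < d) (s y : ℝ) : 0 ≤ hsHd d s y := by
  have := hsg_nonneg ((y - s) / d)
  have := hsg_nonneg ((-y - s) / d)
  unfold hsHd; positivity

lemma hsChi_fderiv_le {w : ℂ → ℝ} (hw : ContDiff ℝ 1 w) {s d : ℝ} (hd : 0 < d) (z : ℂ) :
    ‖fderiv ℝ (fun z => hsChi s d (w z)) z‖ ≤ hsHd d s (w z) * ‖fderiv ℝ w z‖ := by
  have h := ((hsChi_deriv s d (w z)).comp_hasFDerivAt z ((hw.differentiable (by norm_num)) z).hasFDerivAt)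
  have e : fderiv ℝ (fun z => hsChi s d (w z)) z = _ := h.fderiv
  rw [e, norm_smul]
  gcongr
  unfold hsHd
  rw [Real.norm_eq_abs, abs_div, abs_of_pos hd]
  gcongr
  have h1 := hsg_nonneg ((w z - s) / d)
  have h2 := hsg_nonneg ((-w z - s) / d)
  rw [abs_le]; constructor <;> linarith

lemma hsHd_int {d : ℝ} (hd : 0 < d) (y : ℝ) : ∫⁻ s in Set.Ioi (0:ℝ), ENNReal.ofReal (hsHd d s y) ≤ 1 := by
  have hder : ∀ s : ℝ, HasDerivAt (fun s => - hsChi s d y) (hsHd d s y) s := by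
    intro s
    have h1 : HasDerivAt (fun s : ℝ => (y - s) / d) (-1 / d) s := ((hasDerivAt_id s).const_sub y).div_const d
    have h2 : HasDerivAt (fun s : ℝ => (-y - s) / d) (-1 / d) s := ((hasDerivAt_id s).const_sub (-y)).div_const d
    have := (((hsg_hasDeriv _).comp s h1).add ((hsg_hasDeriv _).comp s h2)).neg
    refine HasDerivAt.congr_deriv this ?_
    unfold hsHd; ring
  have hlim : Filter.Tendsto (fun s => - hsChi s d y) Filter.atTop (nhds 0) := by
    apply tendsto_const_nhds.congr'
    filter_upwards [Filter.eventually_ge_atTop |y|] with s hs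
    have := abs_le.1 hs
    unfold hsChi
    rw [smoothTransition.zero_of_nonpos (x := (-y - s) / _) (div_nonpos_of_nonpos_of_nonneg (by linarith) hd.le),
      smoothTransition.zero_of_nonpos (x := (y - s) / _) (div_nonpos_of_nonpos_of_nonneg (by linarith) hd.le)]
    simp
  have hi := integrableOn_Ioi_deriv_of_nonneg' (a := 0) (fun s _ => hder s) (fun s _ => hsHd_nonneg hd s y) hlim
  have hv := integral_Ioi_of_hasDerivAt_of_nonneg' (a := 0) (fun s _ => hder s) (fun s _ => hsHd_nonneg hd s y) hlim
  rw [← ofReal_integral_eq_lintegral_ofReal hi (Filter.Eventually.of_forall fun s => hsHd_nonneg hd s y), hv]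
  rw [← ENNReal.ofReal_one]
  apply ENNReal.ofReal_le_ofReal
  unfold hsChi
  rcases le_total 0 y with h | h
  · rw [smoothTransition.zero_of_nonpos (x := (-y - 0) / _) (div_nonpos_of_nonpos_of_nonneg (by linarith) hd.le)]
    have := smoothTransition.le_one ((y - 0) / d)
    linarith
  · rw [smoothTransition.zero_of_nonpos (x := (y - 0) / _) (div_nonpos_of_nonpos_of_nonneg (by linarith) hd.le)]
    have := smoothTransition.le_one ((-y - 0) / d)
    linarith

lemma hs_coarea {w : ℂ → ℝ} (hw : ContDiff ℝ 1 w) (hc : HasCompactSupport w) {p : ℝ} (hp0 : 0 ≤ p) (hp1 : p ≤ 1) :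
    ∫⁻ s in Set.Ioi (0:ℝ), ENNReal.ofReal (2 * π) * (volume {z : ℂ | s < |w z|} / ENNReal.ofReal π) ^ ((p + 1) / 2)
      ≤ ∫⁻ z, ENNReal.ofReal (‖fderiv ℝ w z‖ * ‖z‖ ^ p) := by
  have hd : ∀ n : ℕ, 0 < 1 / ((n : ℝ) + 1) := fun n => by positivity
  set G : ℕ → ℝ → ENNReal := fun n s => ∫⁻ z, ENNReal.ofReal (hsHd (1 / ((n : ℝ) + 1)) s (w z)) * ENNReal.ofReal (‖fderiv ℝ w z‖ * ‖z‖ ^ p) with hG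
  have hwc : Continuous w := hw.continuous
  have hDm : Measurable fun z => ENNReal.ofReal (‖fderiv ℝ w z‖ * ‖z‖ ^ p) := by
    have : Continuous fun z => fderiv ℝ w z := hw.continuous_fderiv (by norm_num)
    exact ((this.norm.measurable).mul (measurable_norm.pow_const p)).ennreal_ofReal
  have hjm : ∀ n : ℕ, Measurable fun x : ℝ × ℂ => ENNReal.ofReal (hsHd (1 / ((n : ℝ) + 1)) x.1 (w x.2)) * ENNReal.ofReal (‖fderiv ℝ w x.2‖ * ‖x.2‖ ^ p) := by
    intro n
    have h1 : Continuous fun x : ℝ × ℂ => hsHd (1 / ((n : ℝ) + 1)) x.1 (w x.2) := by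
      unfold hsHd
      have := hsg_cont
      have a1 : Continuous fun x : ℝ × ℂ => (w x.2 - x.1) / (1 / ((n : ℝ) + 1)) := (by fun_prop : Continuous fun x : ℝ × ℂ => (w x.2 - x.1)).div_const _
      have a2 : Continuous fun x : ℝ × ℂ => (-w x.2 - x.1) / (1 / ((n : ℝ) + 1)) := (by fun_prop : Continuous fun x : ℝ × ℂ => (-w x.2 - x.1)).div_const _
      exact ((this.comp a1).add (this.comp a2)).div_const _
    exact h1.measurable.ennreal_ofReal.mul (hDm.comp measurable_snd)
  have hGm : ∀ n, Measurable (G n) := fun n => (hjm n).lintegral_prod_right'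
  calc _ ≤ ∫⁻ s in Set.Ioi (0:ℝ), Filter.liminf (fun n => G n s) Filter.atTop := by
        apply setLIntegral_mono' measurableSet_Ioi
        intro s hs
        refine (hs_level (hsChi_seq hw hc hs) hp0 hp1).trans ?_
        refine Filter.liminf_le_liminf (Filter.Eventually.of_forall fun n => ?_)
        apply lintegral_mono
        intro z
        dsimp only
        rw [← ENNReal.ofReal_mul (hsHd_nonneg (hd n) _ _), ← mul_assoc]
        apply ENNReal.ofReal_le_ofReal
        gcongr
        exact hsChi_fderiv_le hw (hd n) z
    _ ≤ Filter.liminf (fun n => ∫⁻ s in Set.Ioi (0:ℝ), G n s) Filter.atTop := lintegral_liminf_le hGm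
    _ ≤ Filter.liminf (fun n : ℕ => ∫⁻ z, ENNReal.ofReal (‖fderiv ℝ w z‖ * ‖z‖ ^ p)) Filter.atTop := by
        refine Filter.liminf_le_liminf (Filter.Eventually.of_forall fun n => ?_)
        rw [hG]
        dsimp only
        rw [lintegral_lintegral_swap (hjm n).aemeasurable]
        apply lintegral_mono
        intro z
        dsimp only
        rw [lintegral_mul_const' _ _ ENNReal.ofReal_ne_top]
        exact (mul_le_mul' (hsHd_int (hd n) _) le_rfl).trans_eq (one_mul _)
    _ = _ := by simp

lemma hs_holder {w : ℂ → ℝ} (hw : Continuous w) (hc : HasCompactSupport w) {q r : ℝ} (hq0 : 0 < q) (hq1 : q ≤ 1) (hr : r = 1 / q) :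
    (∫⁻ z, ENNReal.ofReal (|w z| ^ r)) ^ q ≤ ∫⁻ s in Set.Ioi (0:ℝ), (volume {z : ℂ | s < |w z|}) ^ q := by
  have hr0 : 0 < r := by rw [hr]; positivity
  have hqr : q * r = 1 := by rw [hr]; field_simp
  set N := ∫⁻ z, ENNReal.ofReal (|w z| ^ r) with hN
  have hcr : Continuous fun z => |w z| ^ r := hw.abs.rpow_const (fun _ => Or.inr hr0.le)
  have hNfin : N ≠ ⊤ := by
    have hcs : HasCompactSupport fun z => |w z| ^ r := by
      refine hc.comp_left (g := fun y : ℝ => |y| ^ r) ?_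
      simp [zero_rpow hr0.ne']
    have hi : Integrable fun z => |w z| ^ r := hcr.integrable_of_hasCompactSupport hcs
    have := hi.lintegral_lt_top
    exact this.ne
  have hm : Measurable fun z => ENNReal.ofReal |w z| := by fun_prop
  have key : N ≤ (∫⁻ s in Set.Ioi (0:ℝ), (volume {z : ℂ | s < |w z|}) ^ q) * N ^ (1 - q) := by
    have hE : ∀ s : ℝ, MeasurableSet {z : ℂ | s < |w z|} := fun s => measurableSet_lt (by fun_prop) (by fun_prop)
    have hgm : Measurable fun z => ENNReal.ofReal (|w z| ^ r) := hcr.measurable.ennreal_ofReal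
    have h1 : ∀ z, ENNReal.ofReal (|w z| ^ r) = ∫⁻ s in Set.Ioi (0:ℝ), (Set.indicator {x : ℝ × ℂ | x.1 < |w x.2|} 1 (s, z)) ^ q * (ENNReal.ofReal (|w z| ^ r)) ^ (1 - q) := by
      intro z
      have hpow : (ENNReal.ofReal (|w z| ^ r)) ^ (1 - q) * ENNReal.ofReal |w z| = ENNReal.ofReal (|w z| ^ r) := by
        rw [ENNReal.ofReal_rpow_of_nonneg (by positivity) (by linarith), ← ENNReal.ofReal_mul (by positivity), ← rpow_mul (abs_nonneg _)]
        congr 1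
        rcases (abs_nonneg (w z)).eq_or_lt with h | h
        · rw [← h, zero_rpow hr0.ne', mul_zero]
        · rw [← rpow_add_one h.ne']; congr 1; nlinarith
      have hind : ∀ s, (Set.indicator {x : ℝ × ℂ | x.1 < |w x.2|} (1 : ℝ × ℂ → ENNReal) (s, z)) ^ q = Set.indicator (Set.Iio |w z|) 1 s := by
        intro s
        by_cases h : s < |w z| <;> simp [Set.indicator, h, hq0]
      simp_rw [hind]
      rw [lintegral_mul_const _ (measurable_one.indicator measurableSet_Iio), lintegral_indicator_one measurableSet_Iio,
        Measure.restrict_apply measurableSet_Iio, Set.inter_comm, Set.Ioi_inter_Iio, Real.volume_Ioo, sub_zero, mul_comm, hpow]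
    have hSm : MeasurableSet {x : ℝ × ℂ | x.1 < |w x.2|} := measurableSet_lt (by fun_prop) (by fun_prop)
    have hjm : Measurable fun x : ℂ × ℝ => (Set.indicator {x : ℝ × ℂ | x.1 < |w x.2|} (1 : ℝ × ℂ → ENNReal) (x.2, x.1)) ^ q * (ENNReal.ofReal (|w x.1| ^ r)) ^ (1 - q) := by
      have a1 : Measurable fun x : ℂ × ℝ => Set.indicator {x : ℝ × ℂ | x.1 < |w x.2|} (1 : ℝ × ℂ → ENNReal) (x.2, x.1) :=
        (measurable_one.indicator hSm).comp measurable_swap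
      exact (a1.pow_const q).mul ((hgm.comp measurable_fst).pow_const _)
    calc N = ∫⁻ z, ∫⁻ s in Set.Ioi (0:ℝ), (Set.indicator {x : ℝ × ℂ | x.1 < |w x.2|} 1 (s, z)) ^ q * (ENNReal.ofReal (|w z| ^ r)) ^ (1 - q) := lintegral_congr h1
      _ = ∫⁻ s in Set.Ioi (0:ℝ), ∫⁻ z, (Set.indicator {x : ℝ × ℂ | x.1 < |w x.2|} 1 (s, z)) ^ q * (ENNReal.ofReal (|w z| ^ r)) ^ (1 - q) :=
        lintegral_lintegral_swap hjm.aemeasurable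
      _ ≤ ∫⁻ s in Set.Ioi (0:ℝ), (volume {z : ℂ | s < |w z|}) ^ q * N ^ (1 - q) := by
        apply lintegral_mono
        intro s
        have hi : ∀ z, Set.indicator {x : ℝ × ℂ | x.1 < |w x.2|} (1 : ℝ × ℂ → ENNReal) (s, z) = Set.indicator {z : ℂ | s < |w z|} 1 z := by
          intro z
          by_cases h : s < |w z| <;> simp [Set.indicator, h]
        simp_rw [hi]
        refine (ENNReal.lintegral_mul_norm_pow_le (measurable_one.indicator (hE s)).aemeasurable hgm.aemeasurable hq0.le (by linarith) (by ring)).trans ?_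
        rw [lintegral_indicator_one (hE s)]
      _ = _ := by rw [lintegral_mul_const' _ _ (ENNReal.rpow_ne_top_of_nonneg (by linarith) hNfin)]
  rcases eq_or_ne N 0 with h0 | h0
  · rw [h0, ENNReal.zero_rpow_of_pos hq0]; exact zero_le
  · have hne : N ^ (1 - q) ≠ 0 := by
      intro h
      rcases ENNReal.rpow_eq_zero_iff.1 h with h | h
      · exact h0 h.1
      · exact hNfin h.1
    have hnt : N ^ (1 - q) ≠ ⊤ := ENNReal.rpow_ne_top_of_nonneg (by linarith) hNfin
    rw [← ENNReal.mul_le_mul_iff_left hne hnt, ← ENNReal.rpow_add _ _ h0 hNfin]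
    simpa using key

open MeasureTheory Real

lemma hs_complex {w : ℂ → ℝ} (hw : ContDiff ℝ 1 w) (hc : HasCompactSupport w) {p r : ℝ} (hp0 : 0 ≤ p) (hp1 : p ≤ 1)
    (hr : r = 1 / ((p + 1) / 2)) :
    ENNReal.ofReal (2 * π) * (∫⁻ z, ENNReal.ofReal (|w z| ^ r)) ^ ((p + 1) / 2) ≤
      ENNReal.ofReal (π ^ ((p + 1) / 2)) * ∫⁻ z, ENNReal.ofReal (‖fderiv ℝ w z‖ * ‖z‖ ^ p) := by
  have hq : 0 < (p + 1) / 2 := by linarith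
  have h1 := hs_holder hw.continuous hc hq (by linarith) hr
  have h2 := hs_coarea hw hc hp0 hp1
  set q := (p + 1) / 2
  have hpi : ENNReal.ofReal (π ^ q) = ENNReal.ofReal π ^ q := (ENNReal.ofReal_rpow_of_pos pi_pos).symm
  have hpi0 : ENNReal.ofReal (π ^ q) ≠ 0 := by
    rw [ne_eq, ENNReal.ofReal_eq_zero, not_le]; positivity
  refine le_trans ?_ (mul_le_mul' le_rfl h2)
  rw [← lintegral_const_mul' _ _ ENNReal.ofReal_ne_top]
  refine (mul_le_mul' le_rfl h1).trans ?_
  rw [← lintegral_const_mul' _ _ ENNReal.ofReal_ne_top]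
  refine lintegral_mono fun s => ?_
  dsimp only
  rw [ENNReal.div_rpow_of_nonneg _ _ hq.le, ← hpi, mul_left_comm,
    ENNReal.mul_div_cancel hpi0 ENNReal.ofReal_ne_top]

theorem hardy_sobolev_best_constant
    (p : ℝ) (hp0 : 0 ≤ p) (hp1 : p ≤ 1) (r : ℝ) (hr : r = 2 / (p + 1))
    (u : EuclideanSpace ℝ (Fin 2) → ℝ)
    (hu : ContDiff ℝ (⊤ : ℕ∞) u) (hsupp : HasCompactSupport u) :
    (∫ x, |u x| ^ r) ^ (1 / r) ≤
      π ^ (1 / r) / (2 * π) * ∫ x, ‖fderiv ℝ u x‖ * ‖x‖ ^ p := by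
  have hr' : r = 1 / ((p + 1) / 2) := by rw [hr]; field_simp
  have hq : 1 / r = (p + 1) / 2 := by rw [hr']; field_simp
  have hr0 : 0 < r := by rw [hr]; positivity
  have hq0 : 0 < (p + 1) / 2 := by linarith
  rw [hq]
  let L : ℂ ≃ₗᵢ[ℝ] EuclideanSpace ℝ (Fin 2) := Complex.orthonormalBasisOneI.repr
  have hu1 : ContDiff ℝ 1 u := hu.of_le (by exact_mod_cast le_top)
  have hmp : MeasurePreserving L volume volume := L.measurePreserving
  have hw : ContDiff ℝ 1 (u ∘ L) := hu1.comp L.contDiff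
  have hwc : HasCompactSupport (u ∘ L) := hsupp.comp_homeomorph L.toHomeomorph
  have key := hs_complex hw hwc hp0 hp1 hr'
  have hfd : ∀ z, ‖fderiv ℝ (u ∘ L) z‖ = ‖fderiv ℝ u (L z)‖ := by
    intro z
    have e : fderiv ℝ (u ∘ L) z = (fderiv ℝ u (L z)).comp (L : ℂ →L[ℝ] EuclideanSpace ℝ (Fin 2)) :=
      (((hu1.differentiable (by norm_num)) (L z)).hasFDerivAt.comp z
        (L : ℂ →L[ℝ] EuclideanSpace ℝ (Fin 2)).hasFDerivAt).fderiv
    rw [e]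
    exact ContinuousLinearMap.opNorm_comp_linearIsometryEquiv _ L
  have hc1 : Continuous fun x => |u x| ^ r := hu1.continuous.abs.rpow_const (fun _ => Or.inr hr0.le)
  have hfc : Continuous fun x => fderiv ℝ u x := hu1.continuous_fderiv (by norm_num)
  have hc2 : Continuous fun x => ‖fderiv ℝ u x‖ * ‖x‖ ^ p :=
    hfc.norm.mul (continuous_norm.rpow_const (fun _ => Or.inr hp0))
  have hi1 : Integrable fun x => |u x| ^ r := by
    apply hc1.integrable_of_hasCompactSupport
    refine hsupp.comp_left (g := fun y : ℝ => |y| ^ r) ?_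
    simp [zero_rpow hr0.ne']
  have hi2 : Integrable fun x => ‖fderiv ℝ u x‖ * ‖x‖ ^ p := by
    apply hc2.integrable_of_hasCompactSupport
    exact (hsupp.fderiv (𝕜 := ℝ)).norm.mul_right
  have n1 : ∀ x, 0 ≤ |u x| ^ r := fun x => by positivity
  have n2 : ∀ x, 0 ≤ ‖fderiv ℝ u x‖ * ‖x‖ ^ p := fun x => by positivity
  have e1 : ∫⁻ z, ENNReal.ofReal (|(u ∘ L) z| ^ r) = ENNReal.ofReal (∫ x, |u x| ^ r) := by
    rw [ofReal_integral_eq_lintegral_ofReal hi1 (Filter.Eventually.of_forall n1)]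
    exact hmp.lintegral_comp hc1.measurable.ennreal_ofReal
  have e2 : ∫⁻ z, ENNReal.ofReal (‖fderiv ℝ (u ∘ L) z‖ * ‖z‖ ^ p) = ENNReal.ofReal (∫ x, ‖fderiv ℝ u x‖ * ‖x‖ ^ p) := by
    rw [ofReal_integral_eq_lintegral_ofReal hi2 (Filter.Eventually.of_forall n2), ← hmp.lintegral_comp hc2.measurable.ennreal_ofReal]
    refine lintegral_congr fun z => ?_
    rw [hfd, L.norm_map]
  rw [e1, e2] at key
  have N1 : 0 ≤ ∫ x, |u x| ^ r := integral_nonneg n1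
  have N2 : 0 ≤ ∫ x, ‖fderiv ℝ u x‖ * ‖x‖ ^ p := integral_nonneg n2
  rw [ENNReal.ofReal_rpow_of_nonneg N1 hq0.le, ← ENNReal.ofReal_mul (by positivity), ← ENNReal.ofReal_mul (by positivity),
    ENNReal.ofReal_le_ofReal_iff (by positivity)] at key
  rw [div_mul_eq_mul_div, le_div_iff₀ (by positivity), mul_comm]
  exact key
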